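/- arXiv:2407.08373 — 5 statements merged into one kernel-verified Lean document; each statement's English description precedes it below -/
import Mathlib

section
/- For every s ∈ (0,1) and p ∈ [1,∞) with sp < 1, the sharp fractional Hardy constant of Ω = ℝ∖ℤ vanishes: 𝔥_{s,p}(ℝ∖ℤ) = 0. -/
open MeasureTheory Metric Set Filter
open scoped ENNReal NNReal

/-- The `p`-th power of the Gagliardo `(s,p)`-seminorm of `u : ℝ → ℝ` on `A ⊆ ℝ`,
valued in `[0,∞]`. -/
noncomputable def gagliardo1 (s p : ℝ) (A : Set ℝ) (u : ℝ → ℝ) : ℝ≥0∞ :=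
  ∫⁻ x in A, ∫⁻ y in A, ENNReal.ofReal (|u x - u y| ^ p / |x - y| ^ (1 + s * p))

/-- The sharp fractional Hardy constant `𝔥_{s,p}(Ω)` for `Ω ⊆ ℝ`, an element of `[0,∞]`. -/
noncomputable def hardyConst1 (s p : ℝ) (Ω : Set ℝ) : ℝ≥0∞ :=
  sInf { c : ℝ≥0∞ | ∃ u : ℝ → ℝ,
    ContDiff ℝ (⊤ : ℕ∞) u ∧ HasCompactSupport u ∧ tsupport u ⊆ Ω ∧
    (∫ x in Ω, |u x| ^ p / Metric.infDist x (frontier Ω) ^ (s * p)) = 1 ∧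
    c = gagliardo1 s p Set.univ u }

noncomputable def GG (σ : ℝ) (f : ℝ → ℝ) : ℝ≥0∞ :=
  ∫⁻ x, ∫⁻ y, ENNReal.ofReal (|f x - f y| / |x - y| ^ (1 + σ))

lemma GG_meas (σ : ℝ) (f : ℝ → ℝ) (hf : Continuous f) :
    Measurable (fun z : ℝ × ℝ => ENNReal.ofReal (|f z.1 - f z.2| / |z.1 - z.2| ^ (1 + σ))) := by
  have := hf.measurable
  fun_prop

lemma lint_scale (g : ℝ → ℝ≥0∞) (hg : Measurable g) (a l : ℝ) (hl : 0 < l) :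
    ∫⁻ x, g ((x - a) / l) = ENNReal.ofReal l * ∫⁻ x, g x := by
  rw [lintegral_sub_right_eq_self (fun x => g (x / l)) a]
  have h := Real.map_volume_mul_left (a := l⁻¹) (inv_ne_zero hl.ne')
  have h2 : ∫⁻ x, g x ∂(Measure.map (l⁻¹ * ·) volume) = ∫⁻ x, g (l⁻¹ * x) :=
    lintegral_map hg (by fun_prop)
  rw [h, lintegral_smul_measure, inv_inv, abs_of_pos hl] at h2
  simp only [smul_eq_mul] at h2
  rw [h2]
  congr 1; ext x; congr 1; field_simp

lemma GG_scale (σ : ℝ) (f : ℝ → ℝ) (hf : Continuous f) (a l : ℝ) (hl : 0 < l) :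
    GG σ (fun x => f ((x - a) / l)) = ENNReal.ofReal (l ^ (1 - σ)) * GG σ f := by
  have hm := GG_meas σ f hf
  have key : ∀ x y : ℝ, ENNReal.ofReal (|f ((x - a) / l) - f ((y - a) / l)| / |x - y| ^ (1 + σ))
      = ENNReal.ofReal (l ^ (-(1 + σ))) * ENNReal.ofReal (|f ((x - a) / l) - f ((y - a) / l)| /
          |(x - a) / l - (y - a) / l| ^ (1 + σ)) := by
    intro x y
    rw [← ENNReal.ofReal_mul (by positivity)]
    congr 1
    have : (x - a) / l - (y - a) / l = (x - y) / l := by ring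
    rw [this, abs_div, abs_of_pos hl, Real.div_rpow (abs_nonneg _) hl.le, Real.rpow_neg hl.le]
    have : l ^ (1 + σ) ≠ 0 := (Real.rpow_pos_of_pos hl _).ne'
    rw [div_div_eq_mul_div]
    field_simp
  unfold GG
  simp_rw [key]
  have h1 : ∀ x : ℝ, ∫⁻ y, ENNReal.ofReal (l ^ (-(1 + σ))) * ENNReal.ofReal (|f ((x - a) / l) - f ((y - a) / l)| /
          |(x - a) / l - (y - a) / l| ^ (1 + σ)) = ENNReal.ofReal (l ^ (-(1 + σ))) * (ENNReal.ofReal l *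
          ∫⁻ y, ENNReal.ofReal (|f ((x - a) / l) - f y| / |(x - a) / l - y| ^ (1 + σ))) := by
    intro x
    rw [lintegral_const_mul' _ _ ENNReal.ofReal_ne_top]
    congr 1
    exact lint_scale (fun y => ENNReal.ofReal (|f ((x - a) / l) - f y| / |(x - a) / l - y| ^ (1 + σ)))
      (hm.comp (measurable_const.prodMk measurable_id)) a l hl
  simp_rw [h1]
  rw [lintegral_const_mul' _ _ ENNReal.ofReal_ne_top, lintegral_const_mul' _ _ ENNReal.ofReal_ne_top,
    lint_scale (fun x => ∫⁻ y, ENNReal.ofReal (|f x - f y| / |x - y| ^ (1 + σ)))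
      hm.lintegral_prod_right' a l hl, ← mul_assoc, ← mul_assoc, ← ENNReal.ofReal_mul (by positivity),
      ← ENNReal.ofReal_mul (by positivity)]
  congr 2
  have e : l ^ (1 - σ) = l ^ (-(1 + σ)) * l ^ (1:ℝ) * l ^ (1:ℝ) := by
    rw [← Real.rpow_add hl, ← Real.rpow_add hl]; congr 1; ring
  rw [e, Real.rpow_one]

lemma GG_mul (σ : ℝ) (f g : ℝ → ℝ) (hf : Continuous f) (hg : Continuous g)
    (hf1 : ∀ x, f x ∈ Icc (0:ℝ) 1) (hg1 : ∀ x, g x ∈ Icc (0:ℝ) 1) :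
    GG σ (fun x => f x * g x) ≤ GG σ f + GG σ g := by
  unfold GG
  rw [← lintegral_add_left (GG_meas σ f hf).lintegral_prod_right']
  refine lintegral_mono fun x => ?_
  have hfm := hf.measurable
  simp only []
  rw [← lintegral_add_left (by fun_prop)]
  refine lintegral_mono fun y => ?_
  rw [← ENNReal.ofReal_add (by positivity) (by positivity), ← add_div]
  refine ENNReal.ofReal_le_ofReal ?_
  gcongr
  have : f x * g x - f y * g y = (f x - f y) * g x + f y * (g x - g y) := by ring
  rw [this]
  refine (abs_add_le _ _).trans ?_
  rw [abs_mul, abs_mul, abs_of_nonneg (hg1 x).1, abs_of_nonneg (hf1 y).1]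
  have := (hg1 x).2
  have := (hf1 y).2
  nlinarith [abs_nonneg (f x - f y), abs_nonneg (g x - g y)]

lemma GG_one_sub (σ : ℝ) (f : ℝ → ℝ) : GG σ (fun x => 1 - f x) = GG σ f := by
  unfold GG
  congr 1; ext x; congr 1; ext y
  rw [show 1 - f x - (1 - f y) = f y - f x by ring, abs_sub_comm]

lemma GG_prod (σ : ℝ) {ι : Type*} (t : Finset ι) (f : ι → ℝ → ℝ) (hf : ∀ i, Continuous (f i))
    (hf1 : ∀ i x, f i x ∈ Icc (0:ℝ) 1) :
    GG σ (fun x => ∏ i ∈ t, f i x) ≤ ∑ i ∈ t, GG σ (f i) := by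
  classical
  induction t using Finset.induction_on with
  | empty => simp [GG]
  | insert a t ha ih =>
    simp only [Finset.prod_insert ha, Finset.sum_insert ha]
    refine (GG_mul σ _ _ (hf a) (by fun_prop) (hf1 a) ?_).trans (by gcongr)
    intro x
    exact ⟨Finset.prod_nonneg fun i _ => (hf1 i x).1, Finset.prod_le_one (fun i _ => (hf1 i x).1) fun i _ => (hf1 i x).2⟩

lemma ker_int (σ L : ℝ) (h0 : 0 < σ) (h1 : σ < 1) (hL : 0 ≤ L) :
    ∫⁻ h : ℝ, ENNReal.ofReal (min (L * |h|) 1 / |h| ^ (1 + σ)) < ∞ := by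
  have : Integrable (fun h : ℝ => min (L * ‖h‖) 1 / ‖h‖ ^ (1 + σ)) := by
    rw [integrable_fun_norm_addHaar volume (f := fun r => min (L * r) 1 / r ^ (1 + σ))]
    simp only [Module.finrank_self, Nat.sub_self, pow_zero, one_smul]
    rw [← Ioc_union_Ioi_eq_Ioi (zero_le_one' ℝ)]
    have hm : Measurable (fun r : ℝ => min (L * r) 1 / r ^ (1 + σ)) := by fun_prop
    refine IntegrableOn.union ?_ ?_
    · have := (intervalIntegral.intervalIntegrable_rpow' (a := 0) (b := 1) (r := -σ) (by linarith)).const_mul L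
      rw [intervalIntegrable_iff_integrableOn_Ioc_of_le zero_le_one] at this
      refine Integrable.mono' this hm.aestronglyMeasurable ?_
      refine (ae_restrict_iff' measurableSet_Ioc).2 (Eventually.of_forall fun r hr => ?_)
      have hr0 := hr.1
      rw [Real.norm_of_nonneg (by positivity), div_le_iff₀ (by positivity), mul_assoc, ← Real.rpow_add hr0]
      simp
    · have := integrableOn_Ioi_rpow_of_lt (a := -(1 + σ)) (c := 1) (by linarith) one_pos
      refine Integrable.mono' this hm.aestronglyMeasurable ?_
      refine (ae_restrict_iff' measurableSet_Ioi).2 (Eventually.of_forall fun r hr => ?_)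
      have hr0 : 0 < r := one_pos.trans hr
      rw [Real.norm_of_nonneg (by positivity), div_le_iff₀ (by positivity), ← Real.rpow_add hr0]
      simp
  exact this.lintegral_lt_top

lemma GG_fin (σ : ℝ) (h0 : 0 < σ) (h1 : σ < 1) (f : ℝ → ℝ) (L : ℝ≥0) (hf : LipschitzWith L f)
    (hf1 : ∀ x, f x ∈ Icc (0:ℝ) 1) (hs : ∀ x, 2 < |x| → f x = 0) : GG σ f < ∞ := by
  set k : ℝ → ℝ≥0∞ := fun h => ENNReal.ofReal (min (L * |h|) 1 / |h| ^ (1 + σ)) with hk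
  have hkm : Measurable k := by fun_prop
  set I : ℝ → ℝ≥0∞ := (Icc (-2:ℝ) 2).indicator 1 with hI
  have hIm : Measurable I := measurable_one.indicator measurableSet_Icc
  have hI1 : ∀ x, f x ≠ 0 → I x = 1 := by
    intro x hx
    have : |x| ≤ 2 := by by_contra! h; exact hx (hs x h)
    exact indicator_of_mem (show x ∈ Icc (-2:ℝ) 2 from abs_le.1 this) _
  have hkI : ∫⁻ x, ∫⁻ y, I x * k (x - y) < ∞ := by
    have : ∀ x, ∫⁻ y, I x * k (x - y) = I x * ∫⁻ y, k y := by
      intro x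
      rw [lintegral_const_mul _ (by fun_prop), lintegral_sub_left_eq_self k x]
    simp_rw [this]
    rw [lintegral_mul_const _ hIm, lintegral_indicator_one measurableSet_Icc]
    exact ENNReal.mul_lt_top (by simp) (ker_int σ L h0 h1 L.2)
  have hkI2 : ∫⁻ x, ∫⁻ y, I y * k (x - y) < ∞ := by
    rw [lintegral_lintegral_swap (by fun_prop)]
    convert hkI using 5 with x y
    simp only [hk]
    rw [abs_sub_comm]
  have hb : GG σ f ≤ (∫⁻ x, ∫⁻ y, I x * k (x - y)) + ∫⁻ x, ∫⁻ y, I y * k (x - y) := by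
    rw [← lintegral_add_left (by fun_prop)]
    refine lintegral_mono fun x => ?_
    rw [← lintegral_add_left (by fun_prop)]
    refine lintegral_mono fun y => ?_
    rw [← add_mul]
    by_cases hxy : f x = 0 ∧ f y = 0
    · simp [hxy.1, hxy.2]
    · have h1 : 1 ≤ I x + I y := by
        rw [not_and_or] at hxy
        rcases hxy with h | h
        · rw [hI1 x h]; exact le_self_add
        · rw [hI1 y h]; exact le_add_self
      calc _ ≤ k (x - y) := by
            refine ENNReal.ofReal_le_ofReal ?_
            gcongr
            refine le_min (hf.dist_le_mul x y) ?_
            rw [abs_le]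
            have := hf1 x; have := hf1 y
            simp only [mem_Icc] at *
            constructor <;> linarith
        _ ≤ _ := by
            conv_lhs => rw [← one_mul (k (x - y))]
            gcongr
  exact hb.trans_lt (ENNReal.add_lt_top.2 ⟨hkI, hkI2⟩)

lemma frontier_Om : frontier ((Set.range ((↑) : ℤ → ℝ))ᶜ) = Set.range ((↑) : ℤ → ℝ) := by
  rw [frontier_compl, Int.isClosedEmbedding_coe_real.isClosed_range.frontier_eq,
    interior_eq_empty_iff_dense_compl.2 ((Set.countable_range _).dense_compl ℝ), Set.sdiff_empty]

lemma hdist_pos (x : ℝ) (hx : x ∈ (Set.range ((↑) : ℤ → ℝ))ᶜ) :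
    0 < infDist x (Set.range ((↑) : ℤ → ℝ)) :=
  (Int.isClosedEmbedding_coe_real.isClosed_range.notMem_iff_infDist_pos (Set.range_nonempty _)).1 hx

lemma dist_le1 (x : ℝ) : infDist x (Set.range ((↑) : ℤ → ℝ)) ≤ 1 := by
  refine (infDist_le_dist_of_mem (Set.mem_range_self ⌊x⌋)).trans ?_
  rw [Real.dist_eq, Int.self_sub_floor, abs_of_nonneg (Int.fract_nonneg x)]
  exact (Int.fract_lt_one x).le

lemma integ (σ p : ℝ) (hp : 1 ≤ p) (u : ℝ → ℝ) (hu : Continuous u) (hc : HasCompactSupport u)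
    (ht : tsupport u ⊆ (Set.range ((↑) : ℤ → ℝ))ᶜ) :
    Integrable (fun x => |u x| ^ p / infDist x (Set.range ((↑) : ℤ → ℝ)) ^ σ) := by
  have h1 : IntegrableOn (fun x => |u x| ^ p / infDist x (Set.range ((↑) : ℤ → ℝ)) ^ σ)
      (tsupport u) := by
    refine ContinuousOn.integrableOn_compact hc ?_
    refine ContinuousOn.div ?_ ?_ ?_
    · exact (hu.abs.rpow_const fun x => Or.inr (by linarith)).continuousOn
    · exact (continuous_infDist_pt _).continuousOn.rpow_const
        fun x hx => Or.inl (hdist_pos x (ht hx)).ne'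
    · intro x hx
      exact (Real.rpow_pos_of_pos (hdist_pos x (ht hx)) _).ne'
  refine (integrableOn_iff_integrable_of_support_subset ?_).1 h1
  intro x hx
  refine subset_tsupport u ?_
  intro h0
  apply hx
  simp [h0, Real.zero_rpow (by linarith : p ≠ 0)]

lemma gag_smul (s p c : ℝ) (hc : 0 ≤ c) (u : ℝ → ℝ) :
    gagliardo1 s p univ (fun x => c * u x) = ENNReal.ofReal (c ^ p) * gagliardo1 s p univ u := by
  unfold gagliardo1
  rw [← lintegral_const_mul' _ _ ENNReal.ofReal_ne_top]
  congr 1; ext x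
  rw [← lintegral_const_mul' _ _ ENNReal.ofReal_ne_top]
  congr 1; ext y
  rw [← ENNReal.ofReal_mul (by positivity), ← mul_sub, abs_mul, abs_of_nonneg hc,
    Real.mul_rpow hc (abs_nonneg _), mul_div_assoc]

lemma gag_le (s p : ℝ) (hp : 1 ≤ p) (u : ℝ → ℝ) (hu1 : ∀ x, u x ∈ Icc (0:ℝ) 1) :
    gagliardo1 s p univ u ≤ GG (s * p) u := by
  unfold gagliardo1 GG
  simp only [Measure.restrict_univ]
  refine lintegral_mono fun x => lintegral_mono fun y => ENNReal.ofReal_le_ofReal ?_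
  gcongr
  refine Real.rpow_le_self_of_le_one (abs_nonneg _) ?_ hp
  have := hu1 x; have := hu1 y
  simp only [mem_Icc] at *
  rw [abs_le]
  constructor <;> linarith

lemma hardy_le (s p M : ℝ) (hp : 1 ≤ p) (hM : 0 < M) (u : ℝ → ℝ) (hu : ContDiff ℝ (⊤ : ℕ∞) u)
    (hc : HasCompactSupport u) (ht : tsupport u ⊆ (Set.range ((↑) : ℤ → ℝ))ᶜ)
    (hu1 : ∀ x, u x ∈ Icc (0:ℝ) 1)
    (hH : M ≤ ∫ x in (Set.range ((↑) : ℤ → ℝ))ᶜ, |u x| ^ p /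
      infDist x (Set.range ((↑) : ℤ → ℝ)) ^ (s * p)) :
    hardyConst1 s p ((Set.range ((↑) : ℤ → ℝ))ᶜ) ≤ ENNReal.ofReal M⁻¹ * GG (s * p) u := by
  set H := ∫ x in (Set.range ((↑) : ℤ → ℝ))ᶜ, |u x| ^ p /
      infDist x (Set.range ((↑) : ℤ → ℝ)) ^ (s * p) with hHdef
  have hH0 : 0 < H := hM.trans_le hH
  set c : ℝ := H⁻¹ ^ (p⁻¹) with hcdef
  have hc0 : 0 ≤ c := by positivity
  have hcp : c ^ p = H⁻¹ := by
    rw [hcdef, Real.rpow_inv_rpow (by positivity) (by linarith)]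
  have hts : tsupport (fun x => c * u x) ⊆ tsupport u := by
    refine closure_mono ?_
    intro x hx h0
    exact hx (by simp [h0])
  refine le_trans (b := gagliardo1 s p univ (fun x => c * u x)) (sInf_le ?_) ?_
  · refine ⟨fun x => c * u x, contDiff_const.mul hu, hc.mono' ((subset_tsupport _).trans hts), hts.trans ht, ?_, rfl⟩
    rw [frontier_Om]
    have : ∀ x, |c * u x| ^ p / infDist x (Set.range ((↑) : ℤ → ℝ)) ^ (s * p) =
        H⁻¹ * (|u x| ^ p / infDist x (Set.range ((↑) : ℤ → ℝ)) ^ (s * p)) := by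
      intro x
      rw [abs_mul, abs_of_nonneg hc0, Real.mul_rpow hc0 (abs_nonneg _), hcp, mul_div_assoc]
    simp_rw [this]
    rw [integral_const_mul, ← hHdef, inv_mul_cancel₀ hH0.ne']
  · rw [gag_smul s p c hc0, hcp]
    gcongr
    exact gag_le s p hp u hu1

lemma exists_eps (c a : ℝ) (ha : 0 < a) : ∃ ε : ℝ, 0 < ε ∧ c * ε ^ a ≤ 1 ∧ c * (4 * ε) ≤ 1 := by
  have h1 : Tendsto (fun ε : ℝ => c * ε ^ a) (nhdsWithin 0 (Ioi 0)) (nhds (c * 0 ^ a)) :=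
    ((Real.continuous_rpow_const ha.le).const_mul c).continuousAt.tendsto.mono_left nhdsWithin_le_nhds
  have h2 : Tendsto (fun ε : ℝ => c * (4 * ε)) (nhdsWithin 0 (Ioi 0)) (nhds (c * (4 * 0))) :=
    (by fun_prop : Continuous (fun ε : ℝ => c * (4 * ε))).continuousAt.tendsto.mono_left
      nhdsWithin_le_nhds
  rw [Real.zero_rpow ha.ne', mul_zero] at h1
  rw [mul_zero, mul_zero] at h2
  obtain ⟨ε, ⟨h3, h4⟩, h5⟩ := ((h1.eventually_le_const one_pos).and
    (h2.eventually_le_const one_pos)).and self_mem_nhdsWithin |>.exists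
  exact ⟨ε, h5, h3, h4⟩

lemma main_bound (s p : ℝ) (hp : 1 ≤ p) (hs0 : 0 < s * p) (hsp : s * p < 1) (φ : ℝ → ℝ)
    (hφ : ContDiff ℝ (⊤ : ℕ∞) φ) (hφ1 : ∀ x, φ x ∈ Icc (0:ℝ) 1) (hφs : ∀ x, 2 < |x| → φ x = 0)
    (hφo : ∀ x, |x| ≤ 1 → φ x = 1) (N : ℕ) (hN : 1 ≤ N) :
    hardyConst1 s p ((Set.range ((↑) : ℤ → ℝ))ᶜ) ≤
      ENNReal.ofReal ((N:ℝ) ^ (-(s * p)) + (N:ℝ)⁻¹) * GG (s * p) φ := by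
  set σ := s * p with hσ
  set T : Finset ℤ := Finset.Icc (-(2 * (N:ℤ))) (2 * N) with hT
  obtain ⟨ε, hε, he1, he2⟩ := exists_eps (T.card : ℝ) (1 - σ) (by linarith)
  have hN1 : (1:ℝ) ≤ N := by exact_mod_cast hN
  have hN0 : (0:ℝ) < N := by linarith
  set f0 : ℝ → ℝ := fun x => φ ((x - 0) / N) with hf0
  set g : ℤ → ℝ → ℝ := fun k x => 1 - φ ((x - k) / ε) with hg
  set P : ℝ → ℝ := fun x => ∏ k ∈ T, g k x with hP
  set u : ℝ → ℝ := fun x => f0 x * P x with hu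
  have hf0c : ContDiff ℝ (⊤ : ℕ∞) f0 := hφ.comp (by fun_prop)
  have hgc : ∀ k, ContDiff ℝ (⊤ : ℕ∞) (g k) := fun k => contDiff_const.sub (hφ.comp (by fun_prop))
  have hPc : ContDiff ℝ (⊤ : ℕ∞) P := contDiff_prod fun k _ => hgc k
  have huc : ContDiff ℝ (⊤ : ℕ∞) u := hf0c.mul hPc
  have hf01 : ∀ x, f0 x ∈ Icc (0:ℝ) 1 := fun x => hφ1 _
  have hg1 : ∀ k x, g k x ∈ Icc (0:ℝ) 1 := fun k x =>
    ⟨sub_nonneg.2 (hφ1 _).2, sub_le_self _ (hφ1 _).1⟩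
  have hP1 : ∀ x, P x ∈ Icc (0:ℝ) 1 := fun x =>
    ⟨Finset.prod_nonneg fun i _ => (hg1 i x).1,
      Finset.prod_le_one (fun i _ => (hg1 i x).1) fun i _ => (hg1 i x).2⟩
  have hu1 : ∀ x, u x ∈ Icc (0:ℝ) 1 := fun x =>
    ⟨mul_nonneg (hf01 x).1 (hP1 x).1, mul_le_one₀ (hf01 x).2 (hP1 x).1 (hP1 x).2⟩
  -- support
  set C : Set ℝ := {x | |x| ≤ 2 * N} ∩ ⋂ k ∈ T, {x | ε ≤ |x - k|} with hC
  have hCc : IsClosed C := by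
    refine (isClosed_le (by fun_prop) (by fun_prop)).inter ?_
    exact isClosed_biInter fun k _ => isClosed_le (by fun_prop) (by fun_prop)
  have hsC : Function.support u ⊆ C := by
    intro x hx
    refine ⟨?_, ?_⟩
    · by_contra h
      apply hx
      have : f0 x = 0 := by
        apply hφs
        rw [sub_zero, abs_div, abs_of_pos hN0, lt_div_iff₀ hN0]
        exact not_le.1 h
      simp [hu, this]
    · refine mem_iInter₂.2 fun k hk => ?_
      by_contra h
      apply hx
      have : g k x = 0 := by
        simp only [hg]
        rw [hφo, sub_self]
        rw [abs_div, abs_of_pos hε, div_le_one hε]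
        exact (not_le.1 h).le
      simp only [hu, hP]
      rw [Finset.prod_eq_zero hk this, mul_zero]
  have htC : tsupport u ⊆ C := closure_minimal hsC hCc
  have hcs : HasCompactSupport u := by
    refine HasCompactSupport.of_support_subset_isCompact (K := Icc (-(2 * N : ℝ)) (2 * N)) isCompact_Icc ?_
    exact fun x hx => abs_le.1 (show |x| ≤ 2 * N from (hsC hx).1)
  have hCO : C ⊆ (Set.range ((↑) : ℤ → ℝ))ᶜ := by
    rintro x ⟨hx1, hx2⟩ ⟨k, rfl⟩
    have hk : k ∈ T := by
      rw [hT, Finset.mem_Icc]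
      have := abs_le.1 (show |(k:ℝ)| ≤ 2 * N from hx1)
      constructor
      · exact_mod_cast this.1
      · exact_mod_cast this.2
    have := mem_iInter₂.1 hx2 k hk
    simp only [mem_ofPred_eq, sub_self, abs_zero] at this
    linarith
  have ht := htC.trans hCO
  -- lower bound
  have hH : (N:ℝ) ≤ ∫ x in (Set.range ((↑) : ℤ → ℝ))ᶜ, |u x| ^ p /
      infDist x (Set.range ((↑) : ℤ → ℝ)) ^ (s * p) := by
    have hint := integ (s * p) p hp u huc.continuous hcs ht
    set B : Set ℝ := ⋃ k ∈ T, Icc ((k:ℝ) - 2 * ε) (k + 2 * ε) with hB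
    set S : Set ℝ := Icc (-(N:ℝ)) N \ B with hS
    have hBm : MeasurableSet B := Finset.measurableSet_biUnion _ fun k _ => measurableSet_Icc
    have hSm : MeasurableSet S := measurableSet_Icc.diff hBm
    have huS : ∀ x ∈ S, u x = 1 := by
      rintro x ⟨hx1, hx2⟩
      have h1 : f0 x = 1 := by
        apply hφo
        rw [sub_zero, abs_div, abs_of_pos hN0, div_le_one hN0]
        exact abs_le.2 hx1
      have h2 : P x = 1 := by
        refine Finset.prod_eq_one fun k hk => ?_
        simp only [hg]
        rw [hφs, sub_zero]
        rw [abs_div, abs_of_pos hε, lt_div_iff₀ hε]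
        by_contra! h
        have := abs_le.1 h
        exact hx2 (mem_iUnion₂.2 ⟨k, hk, by constructor <;> linarith⟩)
      simp [hu, h1, h2]
    have hSO : S ⊆ (Set.range ((↑) : ℤ → ℝ))ᶜ := fun x hx =>
      hCO (hsC (by rw [Function.mem_support, huS x hx]; exact one_ne_zero))
    have hBle : volume B ≤ ENNReal.ofReal 1 := by
      refine (measure_biUnion_finset_le T _).trans ?_
      have h4 : ∀ k : ℤ, (k:ℝ) + 2 * ε - (k - 2 * ε) = 4 * ε := fun k => by ring
      simp only [Real.volume_Icc, h4]
      rw [Finset.sum_const, nsmul_eq_mul, ← ENNReal.ofReal_natCast, ← ENNReal.ofReal_mul (by positivity)]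
      refine ENNReal.ofReal_le_ofReal he2
    have hSge : ENNReal.ofReal N ≤ volume S := by
      refine le_trans ?_ (le_measure_sdiff)
      rw [Real.volume_Icc]
      refine le_trans ?_ (tsub_le_tsub_left hBle _)
      rw [← ENNReal.ofReal_sub _ zero_le_one]
      exact ENNReal.ofReal_le_ofReal (by linarith)
    have hSfin : volume S ≠ ∞ := by
      refine ((measure_mono sdiff_subset).trans_lt (b := volume (Icc (-(N:ℝ)) N)) ?_).ne
      simp
    calc (N:ℝ) ≤ volume.real S := (ENNReal.ofReal_le_iff_le_toReal hSfin).1 hSge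
      _ = ∫ x in S, (1:ℝ) := by simp
      _ ≤ ∫ x in S, |u x| ^ p / infDist x (Set.range ((↑) : ℤ → ℝ)) ^ (s * p) := by
          refine setIntegral_mono_on (integrableOn_const hSfin) hint.integrableOn hSm ?_
          intro x hx
          have := hdist_pos x (hSO hx)
          rw [huS x hx, abs_one, Real.one_rpow, le_div_iff₀ (by positivity), one_mul]
          exact Real.rpow_le_one this.le (dist_le1 x) hs0.le
      _ ≤ _ := by
          refine setIntegral_mono_set hint.integrableOn ?_ (Eventually.of_forall hSO)
          exact Eventually.of_forall fun x => div_nonneg (by positivity) (Real.rpow_nonneg infDist_nonneg _)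
  refine (hardy_le s p N hp hN0 u huc hcs ht hu1 hH).trans ?_
  have hG : GG σ u ≤ ENNReal.ofReal ((N:ℝ) ^ (1 - σ) + 1) * GG σ φ := by
    refine (GG_mul σ f0 P hf0c.continuous hPc.continuous hf01 hP1).trans ?_
    rw [ENNReal.ofReal_add (by positivity) zero_le_one, add_mul]
    refine add_le_add (GG_scale σ φ hφ.continuous 0 N hN0).le ?_
    refine (GG_prod σ T g (fun k => (hgc k).continuous) hg1).trans ?_
    have : ∀ k ∈ T, GG σ (g k) = ENNReal.ofReal (ε ^ (1 - σ)) * GG σ φ := by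
      intro k _
      rw [← GG_scale σ φ hφ.continuous k ε hε]
      exact GG_one_sub σ _
    rw [Finset.sum_congr rfl this, Finset.sum_const, nsmul_eq_mul, ← mul_assoc,
      ← ENNReal.ofReal_natCast, ← ENNReal.ofReal_mul (by positivity)]
    gcongr
  refine (mul_le_mul_right hG _).trans ?_
  rw [← mul_assoc, ← ENNReal.ofReal_mul (by positivity)]
  refine le_of_eq ?_
  congr 2
  rw [mul_add, mul_one, ← Real.rpow_neg_one, ← Real.rpow_add hN0]
  congr 2; ring

/-- for `sp < 1`, the sharp fractional Hardy constant of `ℝ∖ℤ` vanishes. -/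
theorem hardy_real_minus_integers (s p : ℝ) (hs : s ∈ Set.Ioo (0 : ℝ) 1) (hp : 1 ≤ p)
    (hsp : s * p < 1) :
    hardyConst1 s p ((Set.range ((↑) : ℤ → ℝ))ᶜ) = 0 := by
  have hs0 : 0 < s * p := mul_pos hs.1 (by linarith)
  let b : ContDiffBump (0:ℝ) := ⟨1, 2, one_pos, one_lt_two⟩
  have hφ : ContDiff ℝ (⊤ : ℕ∞) b := b.contDiff
  have hφ1 : ∀ x, b x ∈ Icc (0:ℝ) 1 := fun x => ⟨b.nonneg, b.le_one⟩
  have hφs : ∀ x, 2 < |x| → b x = 0 := fun x hx => b.zero_of_le_dist (by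
    rw [Real.dist_eq, sub_zero]; exact hx.le)
  have hφo : ∀ x, |x| ≤ 1 → b x = 1 := fun x hx => b.one_of_mem_closedBall (by
    rw [mem_closedBall, Real.dist_eq, sub_zero]; exact hx)
  obtain ⟨L, hL⟩ := ContDiff.lipschitzWith_of_hasCompactSupport b.hasCompactSupport hφ (by simp)
  have hfin := GG_fin (s * p) hs0 hsp b L hL hφ1 hφs
  have hlim : Tendsto (fun N : ℕ => ENNReal.ofReal ((N:ℝ) ^ (-(s * p)) + (N:ℝ)⁻¹) * GG (s * p) b)
      atTop (nhds 0) := by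
    have h1 : Tendsto (fun N : ℕ => (N:ℝ) ^ (-(s * p)) + (N:ℝ)⁻¹) atTop (nhds (0 + 0)) :=
      ((tendsto_rpow_neg_atTop hs0).comp tendsto_natCast_atTop_atTop).add
        tendsto_inv_atTop_nhds_zero_nat
    have h2 := ENNReal.Tendsto.mul_const (b := GG (s * p) b) (ENNReal.tendsto_ofReal h1)
      (Or.inr hfin.ne)
    simpa using h2
  refine le_antisymm (ge_of_tendsto hlim ?_) zero_le
  filter_upwards [eventually_ge_atTop 1] with N hN
  exact main_bound s p hp hs0 hsp b hφ hφ1 hφs hφo N hN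
end

section
/- Let Ω ⊊ ℝ be the union of n ∈ ℕ nonempty bounded open intervals, each of length at most ℓ ∈ (0,∞), such that any two of the intervals are at distance at least δ ∈ (0,∞) from each other, and let Ω^δ = {x ∈ ℝ : dist(x,Ω) < δ} be the open δ-neighborhood of Ω. Then for every s ∈ (0,1) and p ∈ [1,∞) with sp ≤ 1 and every smooth function u with compact support contained in Ω, [u]_{W^{s,p}(Ω^δ)}^p ≥ (2/(sp))·(1 − (ℓ/(ℓ+δ))^{sp}) · ∫_Ω |u|^p/d_Ω^{sp} dx. -/
open MeasureTheory Metric Set Filter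
open scoped ENNReal NNReal

lemma aux_int (q r δ : ℝ) (hq : 0 < q) (hr : 0 < r) (hδ : 0 < δ) :
    ∫⁻ t in Set.Ioo r (r + δ), ENNReal.ofReal (1 / |t| ^ (1 + q)) =
      ENNReal.ofReal ((r ^ (-q) - (r + δ) ^ (-q)) / q) := by
  have hle : r ≤ r + δ := by linarith
  have h0 : (0 : ℝ) ∉ Set.uIcc r (r + δ) := by
    rw [Set.uIcc_of_le hle]; intro h; exact absurd h.1 (not_le.mpr hr)
  have e1 : ∫⁻ t in Set.Ioo r (r + δ), ENNReal.ofReal (1 / |t| ^ (1 + q)) =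
      ∫⁻ t in Set.Ioo r (r + δ), ENNReal.ofReal (t ^ (-(1 + q))) := by
    refine setLIntegral_congr_fun measurableSet_Ioo (fun t ht => ?_)
    have ht0 : 0 < t := hr.trans ht.1
    simp only [abs_of_pos ht0, Real.rpow_neg ht0.le, one_div]
  have hint : IntervalIntegrable (fun t : ℝ => t ^ (-(1 + q))) volume r (r + δ) :=
    intervalIntegral.intervalIntegrable_rpow (Or.inr h0)
  rw [e1, ← ofReal_integral_eq_lintegral_ofReal]
  · rw [← integral_Ioc_eq_integral_Ioo, ← intervalIntegral.integral_of_le hle,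
      integral_rpow (Or.inr ⟨by linarith, h0⟩)]
    congr 1
    have : -(1 + q) + 1 = -q := by ring
    rw [this]
    field_simp
    ring
  · exact ((intervalIntegrable_iff_integrableOn_Ioo_of_le hle).1 hint)
  · refine (ae_restrict_iff' measurableSet_Ioo).2 (Eventually.of_forall fun t ht => ?_)
    exact Real.rpow_nonneg (hr.trans ht.1).le _

lemma aux_right (q r δ x : ℝ) (hq : 0 < q) (hr : 0 < r) (hδ : 0 < δ) :
    ∫⁻ y in Set.Ioo (x + r) (x + r + δ), ENNReal.ofReal (1 / |x - y| ^ (1 + q)) =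
      ENNReal.ofReal ((r ^ (-q) - (r + δ) ^ (-q)) / q) := by
  rw [← aux_int q r δ hq hr hδ]
  have h := (measurePreserving_add_left (volume : Measure ℝ) x).setLIntegral_comp_preimage_emb
    (measurableEmbedding_addLeft x) (fun y => ENNReal.ofReal (1 / |x - y| ^ (1 + q)))
    (Set.Ioo (x + r) (x + r + δ))
  rw [← h]
  have : (fun y => x + y) ⁻¹' Set.Ioo (x + r) (x + r + δ) = Set.Ioo r (r + δ) := by
    ext y; simp [add_assoc]
  rw [this]
  simp

lemma aux_left (q r δ x : ℝ) (hq : 0 < q) (hr : 0 < r) (hδ : 0 < δ) :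
    ∫⁻ y in Set.Ioo (x - r - δ) (x - r), ENNReal.ofReal (1 / |x - y| ^ (1 + q)) =
      ENNReal.ofReal ((r ^ (-q) - (r + δ) ^ (-q)) / q) := by
  rw [← aux_int q r δ hq hr hδ]
  have h := (Measure.measurePreserving_sub_left (volume : Measure ℝ) x).setLIntegral_comp_preimage_emb
    (MeasurableEquiv.subLeft x).measurableEmbedding (fun y => ENNReal.ofReal (1 / |y| ^ (1 + q)))
    (Set.Ioo r (r + δ))
  rw [← h]
  have : (fun y => x - y) ⁻¹' Set.Ioo r (r + δ) = Set.Ioo (x - r - δ) (x - r) := by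
    ext y; simp only [Set.mem_preimage, Set.mem_Ioo]; constructor <;> rintro ⟨h1, h2⟩ <;> constructor <;> linarith
  rw [this]

lemma aux_alg (q r δ ℓ d : ℝ) (hq : 0 < q) (hr : 0 < r) (hδ : 0 < δ) (hrl : r ≤ ℓ)
    (hd : d = 0 ∨ r ≤ d) :
    (1 - (ℓ / (ℓ + δ)) ^ q) / d ^ q ≤ r ^ (-q) - (r + δ) ^ (-q) := by
  have hℓ : 0 < ℓ := hr.trans_le hrl
  have hrd : 0 < r + δ := by linarith
  have e : r ^ (-q) - (r + δ) ^ (-q) = (1 - (r / (r + δ)) ^ q) / r ^ q := by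
    rw [Real.rpow_neg hr.le, Real.rpow_neg hrd.le, Real.div_rpow hr.le hrd.le]
    have := Real.rpow_pos_of_pos hr q
    have := Real.rpow_pos_of_pos hrd q
    field_simp
  rw [e]
  have h1 : (r / (r + δ)) ^ q ≤ (ℓ / (ℓ + δ)) ^ q := by
    apply Real.rpow_le_rpow (by positivity) _ hq.le
    rw [div_le_div_iff₀ hrd (by linarith)]
    nlinarith
  have h2 : (ℓ / (ℓ + δ)) ^ q ≤ 1 := by
    apply Real.rpow_le_one (by positivity) _ hq.le
    rw [div_le_one (by linarith)]; linarith
  have hrq := Real.rpow_pos_of_pos hr q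
  rcases hd with rfl | hd
  · rw [Real.zero_rpow hq.ne', div_zero]
    apply div_nonneg _ hrq.le; linarith
  · have : r ^ q ≤ d ^ q := Real.rpow_le_rpow hr.le hd hq.le
    apply div_le_div₀ <;> linarith


/-- localized fractional Hardy inequality on the `δ`-neighborhood of a union of
`n` nonempty bounded open intervals of length at most `ℓ`, any two at distance at least `δ`. -/
theorem hardy_neighborhood_intervals (n : ℕ) (hn : 0 < n) (a b : Fin n → ℝ)
    (hab : ∀ i, a i < b i) (ℓ δ : ℝ) (hℓ : 0 < ℓ) (hδ : 0 < δ)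
    (hlen : ∀ i, b i - a i ≤ ℓ)
    (hdist : ∀ i j, i ≠ j →
      ∀ x ∈ Set.Ioo (a i) (b i), ∀ y ∈ Set.Ioo (a j) (b j), δ ≤ |x - y|)
    (s p : ℝ) (hs : s ∈ Set.Ioo (0 : ℝ) 1) (hp : 1 ≤ p) (hsp : s * p ≤ 1)
    (u : ℝ → ℝ) (hu : ContDiff ℝ (⊤ : ℕ∞) u) (hcs : HasCompactSupport u)
    (hsupp : tsupport u ⊆ ⋃ i, Set.Ioo (a i) (b i)) :
    ENNReal.ofReal (2 / (s * p) * (1 - (ℓ / (ℓ + δ)) ^ (s * p)) *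
        ∫ x in ⋃ i, Set.Ioo (a i) (b i),
          |u x| ^ p / Metric.infDist x (frontier (⋃ i, Set.Ioo (a i) (b i))) ^ (s * p)) ≤
      gagliardo1 s p (Metric.thickening δ (⋃ i, Set.Ioo (a i) (b i))) u := by
  set Ω : Set ℝ := ⋃ i, Set.Ioo (a i) (b i) with hΩ
  set q := s * p with hqdef
  have hq : 0 < q := mul_pos hs.1 (by linarith)
  have hΩo : IsOpen Ω := isOpen_iUnion fun i => isOpen_Ioo
  have hΩm : MeasurableSet Ω := hΩo.measurableSet
  set T := Metric.thickening δ Ω with hT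
  have hTo : IsOpen T := Metric.isOpen_thickening
  have hΩT : Ω ⊆ T := Metric.self_subset_thickening hδ Ω
  set N := T \ Ω with hN
  have hNm : MeasurableSet N := hTo.measurableSet.diff hΩm
  have hu0 : ∀ y ∉ Ω, u y = 0 := fun y hy => image_eq_zero_of_notMem_tsupport fun h => hy (hsupp h)
  have hnear : ∀ i, ∀ y ∉ Set.Ioo (a i) (b i), (∃ z ∈ Set.Ioo (a i) (b i), |y - z| < δ) → y ∈ N := by
    rintro i y hy ⟨z, hz, hyz⟩
    refine ⟨Metric.mem_thickening_iff.2 ⟨z, Set.mem_iUnion.2 ⟨i, hz⟩, hyz⟩, fun hyΩ => ?_⟩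
    obtain ⟨j, hj⟩ := Set.mem_iUnion.1 hyΩ
    have hji : j ≠ i := by rintro rfl; exact hy hj
    exact absurd (hdist j i hji y hj z hz) (not_le.mpr hyz)
  have hL : ∀ i, Set.Ioo (a i - δ) (a i) ⊆ N := by
    intro i y hy
    refine hnear i y (fun h => absurd h.1 (not_lt.mpr hy.2.le)) ?_
    obtain ⟨z, hz1, hz2⟩ := exists_between (show a i < min (b i) (y + δ) from
      lt_min (hab i) (by linarith [hy.1]))
    refine ⟨z, ⟨hz1, hz2.trans_le (min_le_left _ _)⟩, ?_⟩
    have := hz2.trans_le (min_le_right _ _)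
    rw [abs_lt]; constructor <;> linarith [hy.2]
  have hR : ∀ i, Set.Ioo (b i) (b i + δ) ⊆ N := by
    intro i y hy
    refine hnear i y (fun h => absurd h.2 (not_lt.mpr hy.1.le)) ?_
    obtain ⟨z, hz1, hz2⟩ := exists_between (show max (a i) (y - δ) < b i from
      max_lt (hab i) (by linarith [hy.2]))
    refine ⟨z, ⟨(le_max_left _ _).trans_lt hz1, hz2⟩, ?_⟩
    have := (le_max_right _ _).trans_lt hz1
    rw [abs_lt]; constructor <;> linarith [hy.1]
  have hd : ∀ i, ∀ x ∈ Set.Ioo (a i) (b i), ∀ r, r ≤ x - a i → r ≤ b i - x →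
      Metric.infDist x (frontier Ω) = 0 ∨ r ≤ Metric.infDist x (frontier Ω) := by
    intro i x hx r hr1 hr2
    rcases (frontier Ω).eq_empty_or_nonempty with he | hne
    · left; rw [he, Metric.infDist_empty]
    · right
      refine (Metric.le_infDist hne).2 fun y hy => ?_
      by_contra hlt
      rw [not_le, Real.dist_eq, abs_lt] at hlt
      have : y ∈ Ω := Set.mem_iUnion.2 ⟨i, by linarith [hlt.2], by linarith [hlt.1]⟩
      rw [hΩo.frontier_eq] at hy
      exact hy.2 this
  set θ := 1 - (ℓ / (ℓ + δ)) ^ q with hθ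
  have hθ0 : 0 ≤ θ := by
    have : (ℓ / (ℓ + δ)) ^ q ≤ 1 := by
      apply Real.rpow_le_one (by positivity) _ hq.le
      rw [div_le_one (by linarith)]; linarith
    linarith
  set F : ℝ → ℝ → ℝ≥0∞ := fun x y => ENNReal.ofReal (|u x - u y| ^ p / |x - y| ^ (1 + q)) with hF
  have hum : Measurable u := hu.continuous.measurable
  have hFm : Measurable (Function.uncurry F) := by
    simp only [hF, Function.uncurry_def]
    fun_prop
  have hFs : ∀ x y, F x y = F y x := fun x y => by
    simp only [hF]; rw [abs_sub_comm, abs_sub_comm x y]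
  have hp0 : p ≠ 0 := by linarith
  -- pointwise bound
  have hpt : ∀ x ∈ Ω, ENNReal.ofReal (1 / q * θ * (|u x| ^ p / Metric.infDist x (frontier Ω) ^ q)) ≤
      ∫⁻ y in N, F x y := by
    intro x hx
    obtain ⟨i, hi⟩ := Set.mem_iUnion.1 hx
    have hup : 0 ≤ |u x| ^ p := by positivity
    have eF : ∫⁻ y in N, F x y =
        ENNReal.ofReal (|u x| ^ p) * ∫⁻ y in N, ENNReal.ofReal (1 / |x - y| ^ (1 + q)) := by
      rw [← lintegral_const_mul _ (by fun_prop)]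
      refine setLIntegral_congr_fun hNm fun y hy => ?_
      simp only [hF]
      rw [hu0 y hy.2, sub_zero, ← ENNReal.ofReal_mul hup, mul_one_div]
    have key : ∀ r, 0 < r → r ≤ x - a i → r ≤ b i - x →
        ENNReal.ofReal ((r ^ (-q) - (r + δ) ^ (-q)) / q) ≤
          ∫⁻ y in N, ENNReal.ofReal (1 / |x - y| ^ (1 + q)) →
        ENNReal.ofReal (1 / q * θ * (|u x| ^ p / Metric.infDist x (frontier Ω) ^ q)) ≤
      ∫⁻ y in N, F x y := by
      intro r hr hr1 hr2 hle
      rw [eF]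
      refine le_trans ?_ (mul_le_mul_right hle _)
      rw [← ENNReal.ofReal_mul hup]
      apply ENNReal.ofReal_le_ofReal
      have h1 := aux_alg q r δ ℓ (Metric.infDist x (frontier Ω)) hq hr hδ
        (by linarith [hlen i, hi.2]) (hd i x hi r hr1 hr2)
      calc _ = |u x| ^ p * ((θ / Metric.infDist x (frontier Ω) ^ q) / q) := by ring
        _ ≤ _ := by gcongr
    rcases le_total (x - a i) (b i - x) with h | h
    · refine key (x - a i) (by linarith [hi.1]) le_rfl h ?_
      rw [← aux_left q (x - a i) δ x hq (by linarith [hi.1]) hδ]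
      refine lintegral_mono_set ?_
      rw [sub_sub_cancel]; exact hL i
    · refine key (b i - x) (by linarith [hi.2]) h le_rfl ?_
      rw [← aux_right q (b i - x) δ x hq (by linarith [hi.2]) hδ]
      refine lintegral_mono_set ?_
      rw [add_sub_cancel]; exact hR i
  -- splitting
  have hsplit : 2 * ∫⁻ x in Ω, ∫⁻ y in N, F x y ≤ gagliardo1 s p T u := by
    have hg : gagliardo1 s p T u = ∫⁻ x in T, ∫⁻ y in T, F x y := rfl
    have hTu : T = Ω ∪ N := (Set.union_diff_cancel hΩT).symm
    have hdis : Disjoint Ω N := Set.disjoint_sdiff_right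
    have hNT : N ⊆ T := Set.diff_subset
    have hsw : ∫⁻ x in Ω, ∫⁻ y in N, F x y = ∫⁻ x in N, ∫⁻ y in Ω, F x y := by
      rw [lintegral_lintegral_swap hFm.aemeasurable]
      simp only [hFs]
    rw [hg]
    calc 2 * ∫⁻ x in Ω, ∫⁻ y in N, F x y
        = (∫⁻ x in Ω, ∫⁻ y in N, F x y) + ∫⁻ x in N, ∫⁻ y in Ω, F x y := by
          rw [← hsw, two_mul]
      _ ≤ (∫⁻ x in Ω, ∫⁻ y in T, F x y) + ∫⁻ x in N, ∫⁻ y in T, F x y :=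
          add_le_add (lintegral_mono fun x => lintegral_mono_set hNT)
            (lintegral_mono fun x => lintegral_mono_set hΩT)
      _ = ∫⁻ x in Ω ∪ N, ∫⁻ y in T, F x y := (lintegral_union hNm hdis).symm
      _ = _ := by rw [← hTu]
  refine le_trans ?_ hsplit
  set f : ℝ → ℝ := fun x => |u x| ^ p / Metric.infDist x (frontier Ω) ^ q with hf
  have hf0 : ∀ x, 0 ≤ f x := fun x =>
    div_nonneg (by positivity) (Real.rpow_nonneg Metric.infDist_nonneg _)
  have hI : ENNReal.ofReal (∫ x in Ω, 1 / q * θ * f x) ≤ ∫⁻ x in Ω, ∫⁻ y in N, F x y := by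
    by_cases hi : Integrable (fun x => 1 / q * θ * f x) (volume.restrict Ω)
    · rw [ofReal_integral_eq_lintegral_ofReal hi
        (Eventually.of_forall fun x => mul_nonneg (by positivity) (hf0 x))]
      exact setLIntegral_mono' hΩm hpt
    · rw [integral_undef hi]; simp
  calc _ = 2 * ENNReal.ofReal (∫ x in Ω, 1 / q * θ * f x) := by
        rw [integral_const_mul, ← ENNReal.ofReal_ofNat 2, ← ENNReal.ofReal_mul (by norm_num)]
        congr 1; ring
    _ ≤ _ := mul_le_mul_right hI _
end

section
/- For s ∈ (0,1) and p ∈ (1,∞) with sp < 1, the constant Λ_{s,p} = 2∫₀¹ |1 − t^{(sp−1)/p}|^p/(1−t)^{1+sp} dt + 2/(sp) satisfies Λ_{s,p} < 4/(sp). Moreover, for each fixed s ∈ (0,1), Λ_{s,p} → 4/s as p → 1⁺. -/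
open MeasureTheory Metric Set Filter
open scoped ENNReal NNReal

/-- The constant `Λ_{s,p}`. -/
noncomputable def Lam (s p : ℝ) : ℝ :=
  2 * (∫ t in Set.Ioo (0 : ℝ) 1, |1 - t ^ ((s * p - 1) / p)| ^ p / (1 - t) ^ (1 + s * p)) +
    2 / (s * p)

/-- The integrand. -/
noncomputable def fI (s p t : ℝ) : ℝ :=
  |1 - t ^ ((s * p - 1) / p)| ^ p / (1 - t) ^ (1 + s * p)

noncomputable def gI (r t : ℝ) : ℝ := (t ^ (r - 1) - 1) / (1 - t) ^ (1 + r)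

noncomputable def bI (r q t : ℝ) : ℝ := t ^ (r - 1) * (1 - t) ^ (-q)

lemma fI_meas (s p : ℝ) : Measurable (fI s p) := by
  unfold fI; fun_prop

lemma gI_meas (r : ℝ) : Measurable (gI r) := by
  unfold gI; fun_prop

lemma bI_int {r q : ℝ} (hr : 0 < r) (hq : q < 1) : IntegrableOn (bI r q) (Ioo 0 1) := by
  have h := (Complex.betaIntegral_convergent (u := (r : ℂ)) (v := ((1 - q : ℝ) : ℂ))
    (by simpa using hr) (by rw [Complex.ofReal_re]; linarith)).norm
  rw [intervalIntegrable_iff_integrableOn_Ioo_of_le zero_le_one] at h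
  refine h.congr_fun ?_ measurableSet_Ioo
  intro t ht
  have h1 : (0 : ℝ) < 1 - t := by linarith [ht.2]
  simp only [norm_mul]
  rw [Complex.norm_cpow_eq_rpow_re_of_pos ht.1,
    show (1 - (t : ℂ)) = ((1 - t : ℝ) : ℂ) by push_cast; rfl,
    Complex.norm_cpow_eq_rpow_re_of_pos h1]
  simp [bI]

lemma gI_le {r t : ℝ} (hr : 0 < r) (ht : t ∈ Ioo (0 : ℝ) 1) : gI r t ≤ bI r r t := by
  have h1 : (0 : ℝ) < 1 - t := by linarith [ht.2]
  have e1 : t ≤ t ^ (1 - r) := by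
    have := Real.rpow_le_rpow_of_exponent_ge ht.1 ht.2.le (show 1 - r ≤ 1 by linarith)
    simpa using this
  have e2 : t ^ (r - 1) * t ^ (1 - r) = 1 := by
    rw [← Real.rpow_add ht.1]; simp
  have e3 : (0 : ℝ) < t ^ (r - 1) := Real.rpow_pos_of_pos ht.1 _
  unfold gI bI
  rw [div_le_iff₀ (Real.rpow_pos_of_pos h1 _), mul_assoc, ← Real.rpow_add h1]
  have : -r + (1 + r) = 1 := by ring
  rw [this, Real.rpow_one]
  nlinarith

lemma gI_nonneg {r t : ℝ} (hr : r < 1) (ht : t ∈ Ioo (0 : ℝ) 1) : 0 ≤ gI r t := by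
  have h1 : (0 : ℝ) < 1 - t := by linarith [ht.2]
  have := Real.one_le_rpow_of_pos_of_le_one_of_nonpos ht.1 ht.2.le (show r - 1 ≤ 0 by linarith)
  exact div_nonneg (by linarith) (Real.rpow_nonneg h1.le _)

lemma gI_int {r : ℝ} (hr : 0 < r) (hr1 : r < 1) : IntegrableOn (gI r) (Ioo 0 1) := by
  refine Integrable.mono' (bI_int hr hr1) (gI_meas r).aestronglyMeasurable ?_
  refine (ae_restrict_iff' measurableSet_Ioo).2 (Eventually.of_forall fun t ht => ?_)
  rw [Real.norm_of_nonneg (gI_nonneg hr1 ht)]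
  exact gI_le hr ht

lemma gI_val {r : ℝ} (hr : 0 < r) (hr1 : r < 1) : ∫ t in Ioo 0 1, gI r t = 1 / r := by
  rw [← integral_Ioc_eq_integral_Ioo, ← intervalIntegral.integral_of_le zero_le_one]
  have hi : IntervalIntegrable (gI r) volume 0 1 := by
    rw [intervalIntegrable_iff_integrableOn_Ioo_of_le zero_le_one]; exact gI_int hr hr1
  have := intervalIntegral.integral_eq_sub_of_hasDerivAt_of_tendsto
    (f := fun t : ℝ => (t ^ r - 1) * (1 - t) ^ (-r) / r) (f' := gI r) (fa := -1 / r) (fb := 0)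
    zero_lt_one ?_ hi ?_ ?_
  · rw [this]; ring
  · intro t ht
    have h1 : (0 : ℝ) < 1 - t := by linarith [ht.2]
    have d1 : HasDerivAt (fun t : ℝ => t ^ r - 1) (r * t ^ (r - 1)) t :=
      (Real.hasDerivAt_rpow_const (Or.inl ht.1.ne')).sub_const 1
    have d2 : HasDerivAt (fun t : ℝ => (1 - t) ^ (-r)) ((-1) * (-r) * (1 - t) ^ (-r - 1)) t :=
      ((hasDerivAt_id t).const_sub 1).rpow_const (Or.inl h1.ne')
    refine HasDerivAt.congr_deriv ((d1.mul d2).div_const r) ?_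
    have e1 : (1 - t) ^ (-r) = (1 - t) ^ (-r - 1) * (1 - t) := by
      rw [← Real.rpow_add_one h1.ne']; congr 1; ring
    have e2 : t ^ r = t ^ (r - 1) * t := by
      rw [← Real.rpow_add_one ht.1.ne']; congr 1; ring
    have e3 : ((1 - t) ^ (1 + r))⁻¹ = (1 - t) ^ (-r - 1) := by
      rw [← Real.rpow_neg h1.le]; congr 1; ring
    unfold gI
    rw [div_eq_mul_inv (t ^ (r - 1) - 1), e3, e1, e2]
    generalize (1 - t) ^ (-r - 1) = A
    generalize t ^ (r - 1) = B
    field_simp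
    ring
  · have : ContinuousAt (fun t : ℝ => (t ^ r - 1) * (1 - t) ^ (-r) / r) 0 := by
      refine ContinuousAt.div_const (ContinuousAt.mul ?_ ?_) r
      · exact (Real.continuousAt_rpow_const _ _ (Or.inr hr.le)).sub continuousAt_const
      · exact ContinuousAt.rpow_const (by fun_prop) (Or.inl (by norm_num))
    have h2 := this.tendsto.mono_left (nhdsWithin_le_nhds (s := Ioi 0))
    simpa [Real.zero_rpow hr.ne'] using h2
  · have hz : Tendsto (fun t : ℝ => -((1 - t) ^ (1 - r) / r)) (nhdsWithin 1 (Iio 1)) (nhds 0) := by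
      have : ContinuousAt (fun t : ℝ => -((1 - t) ^ (1 - r) / r)) 1 := by
        refine ContinuousAt.neg (ContinuousAt.div_const ?_ r)
        exact ContinuousAt.rpow_const (by fun_prop) (Or.inr (by linarith))
      have h2 := this.tendsto.mono_left (nhdsWithin_le_nhds (s := Iio 1))
      simpa [Real.zero_rpow (show 1 - r ≠ 0 by linarith)] using h2
    have hev : ∀ᶠ t : ℝ in nhdsWithin 1 (Iio 1), t ∈ Ioo (0 : ℝ) 1 :=
      Ioo_mem_nhdsLT zero_lt_one
    refine tendsto_of_tendsto_of_tendsto_of_le_of_le' hz tendsto_const_nhds ?_ ?_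
    · filter_upwards [hev] with t ht
      have h1 : (0 : ℝ) < 1 - t := by linarith [ht.2]
      have e1 : t ≤ t ^ r := by
        have := Real.rpow_le_rpow_of_exponent_ge ht.1 ht.2.le hr1.le
        simpa using this
      have e3 : (1 - t) ^ (1 - r) = (1 - t) * (1 - t) ^ (-r) := by
        rw [sub_eq_add_neg 1 r, Real.rpow_add h1, Real.rpow_one]
      rw [← neg_div, e3]
      have := Real.rpow_pos_of_pos h1 (-r)
      gcongr
      nlinarith
    · filter_upwards [hev] with t ht
      have h1 : (0 : ℝ) < 1 - t := by linarith [ht.2]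
      have e1 : t ^ r ≤ 1 := Real.rpow_le_one ht.1.le ht.2.le hr.le
      have := Real.rpow_pos_of_pos h1 (-r)
      exact div_nonpos_of_nonpos_of_nonneg (mul_nonpos_of_nonpos_of_nonneg (by linarith) this.le) hr.le

lemma superadd {x p : ℝ} (hx : 1 < x) (hp : 1 < p) : (x - 1) ^ p < x ^ p - 1 := by
  have h0 : 0 < x - 1 := by linarith
  have e1 : (x - 1) ^ p = (x - 1) ^ (p - 1) * (x - 1) := by
    rw [← Real.rpow_add_one h0.ne']; congr 1; ring
  have e2 : x ^ p = x ^ (p - 1) * x := by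
    rw [← Real.rpow_add_one (by linarith)]; congr 1; ring
  have e3 : (x - 1) ^ (p - 1) < x ^ (p - 1) :=
    Real.rpow_lt_rpow h0.le (by linarith) (by linarith)
  have e4 : 1 < x ^ (p - 1) := Real.one_lt_rpow hx (by linarith)
  rw [e1, e2]
  nlinarith

lemma fI_lt {s p t : ℝ} (hp : 1 < p) (hsp : s * p < 1) (ht : t ∈ Ioo (0 : ℝ) 1) :
    fI s p t < gI (s * p) t := by
  have h1 : (0 : ℝ) < 1 - t := by linarith [ht.2]
  have hp0 : 0 < p := by linarith
  have hx : 1 < t ^ ((s * p - 1) / p) :=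
    Real.one_lt_rpow_of_pos_of_lt_one_of_neg ht.1 ht.2
      (div_neg_of_neg_of_pos (by linarith) hp0)
  have h := superadd hx hp
  rw [← Real.rpow_mul ht.1.le, div_mul_cancel₀ _ hp0.ne'] at h
  unfold fI gI
  rw [abs_sub_comm, abs_of_pos (by linarith)]
  exact div_lt_div_of_pos_right h (Real.rpow_pos_of_pos h1 _)

lemma fI_nonneg {s p t : ℝ} (ht : t ∈ Ioo (0 : ℝ) 1) : 0 ≤ fI s p t := by
  have h1 : (0 : ℝ) < 1 - t := by linarith [ht.2]
  unfold fI; positivity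

lemma fI_int {s p : ℝ} (hs : 0 < s) (hp : 1 < p) (hsp : s * p < 1) :
    IntegrableOn (fI s p) (Ioo 0 1) := by
  refine Integrable.mono' (gI_int (r := s * p) (by positivity) hsp)
    (fI_meas s p).aestronglyMeasurable ?_
  refine (ae_restrict_iff' measurableSet_Ioo).2 (Eventually.of_forall fun t ht => ?_)
  rw [Real.norm_of_nonneg (fI_nonneg ht)]
  exact (fI_lt hp hsp ht).le

lemma fI_integral_lt {s p : ℝ} (hs : 0 < s) (hp : 1 < p) (hsp : s * p < 1) :
    ∫ t in Ioo 0 1, fI s p t < 1 / (s * p) := by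
  have hr : 0 < s * p := by positivity
  rw [← gI_val hr hsp, ← sub_pos, ← integral_sub (gI_int hr hsp) (fI_int hs hp hsp),
    ← integral_Ioc_eq_integral_Ioo, ← intervalIntegral.integral_of_le zero_le_one]
  refine intervalIntegral.intervalIntegral_pos_of_pos_on ?_ ?_ zero_lt_one
  · rw [intervalIntegrable_iff_integrableOn_Ioo_of_le zero_le_one]
    exact (gI_int hr hsp).sub (fI_int hs hp hsp)
  · intro t ht
    exact sub_pos.2 (fI_lt hp hsp ht)

lemma bI_mono {s r q t : ℝ} (h1 : s ≤ r) (h2 : r ≤ q) (ht : t ∈ Ioo (0 : ℝ) 1) :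
    bI r r t ≤ bI s q t := by
  have h0 : (0 : ℝ) < 1 - t := by linarith [ht.2]
  unfold bI
  refine mul_le_mul ?_ ?_ (Real.rpow_nonneg h0.le _) (Real.rpow_nonneg ht.1.le _)
  · exact Real.rpow_le_rpow_of_exponent_ge ht.1 ht.2.le (by linarith)
  · exact Real.rpow_le_rpow_of_exponent_ge h0 (by linarith [ht.1]) (by linarith)

lemma fI_tendsto {s : ℝ} (hs : 0 < s) (hs1 : s < 1) :
    Tendsto (fun p => ∫ t in Ioo 0 1, fI s p t) (nhdsWithin 1 (Ioi 1)) (nhds (1 / s)) := by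
  rw [← gI_val hs hs1]
  refine tendsto_integral_filter_of_dominated_convergence (bI s ((1 + s) / 2)) ?_ ?_ ?_ ?_
  · exact Eventually.of_forall fun p => (fI_meas s p).aestronglyMeasurable
  · have hc : Tendsto (fun p : ℝ => s * p) (nhdsWithin 1 (Ioi 1)) (nhds s) := by
      have : ContinuousAt (fun p : ℝ => s * p) 1 := by fun_prop
      simpa using this.tendsto.mono_left (nhdsWithin_le_nhds (s := Ioi 1))
    filter_upwards [self_mem_nhdsWithin,
      hc.eventually (gt_mem_nhds (show s < (1 + s) / 2 by linarith))] with p hp hp2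
    have hp' : 1 < p := hp
    refine (ae_restrict_iff' measurableSet_Ioo).2 (Eventually.of_forall fun t ht => ?_)
    rw [Real.norm_of_nonneg (fI_nonneg ht)]
    exact (fI_lt hp' (by linarith) ht).le.trans
      ((gI_le (by positivity) ht).trans (bI_mono (by nlinarith) hp2.le ht))
  · exact bI_int hs (by linarith)
  · refine (ae_restrict_iff' measurableSet_Ioo).2 (Eventually.of_forall fun t ht => ?_)
    have h0 : (0 : ℝ) < 1 - t := by linarith [ht.2]
    have hx : 1 < t ^ (s - 1) :=
      Real.one_lt_rpow_of_pos_of_lt_one_of_neg ht.1 ht.2 (by linarith)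
    have hc : ContinuousAt (fun p => fI s p t) 1 := by
      unfold fI
      refine ContinuousAt.div ?_ ?_ (Real.rpow_pos_of_pos h0 _).ne'
      · refine ContinuousAt.rpow ?_ continuousAt_id (Or.inr (by simp))
        refine (continuousAt_const.sub (ContinuousAt.rpow continuousAt_const ?_
          (Or.inl ht.1.ne'))).abs
        exact ContinuousAt.div (by fun_prop) continuousAt_id (by simp)
      · exact ContinuousAt.rpow continuousAt_const (by fun_prop) (Or.inl h0.ne')
    have h2 := hc.tendsto.mono_left (nhdsWithin_le_nhds (s := Ioi 1))
    have : fI s 1 t = gI s t := by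
      unfold fI gI
      rw [abs_sub_comm]
      simp only [mul_one, div_one, Real.rpow_one]
      rw [abs_of_pos (by linarith)]
    rwa [this] at h2

/-- `Λ_{s,p} < 4/(sp)` whenever `p > 1` and `sp < 1`, and `Λ_{s,p} → 4/s`
as `p → 1⁺`, for each fixed `s ∈ (0,1)`. -/
theorem Lam_lt_and_tendsto (s : ℝ) (hs : s ∈ Set.Ioo (0 : ℝ) 1) :
    (∀ p : ℝ, 1 < p → s * p < 1 → Lam s p < 4 / (s * p)) ∧
      Filter.Tendsto (fun p : ℝ => Lam s p) (nhdsWithin 1 (Set.Ioi 1)) (nhds (4 / s)) := by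
  obtain ⟨hs0, hs1⟩ := hs
  refine ⟨fun p hp hsp => ?_, ?_⟩
  · have h := fI_integral_lt hs0 hp hsp
    have e : Lam s p = 2 * (∫ t in Ioo 0 1, fI s p t) + 2 / (s * p) := rfl
    have e2 : 4 / (s * p) = 2 * (1 / (s * p)) + 2 / (s * p) := by ring
    rw [e, e2]
    linarith
  · have h := fI_tendsto hs0 hs1
    have hc : Tendsto (fun p : ℝ => 2 / (s * p)) (nhdsWithin 1 (Ioi 1)) (nhds (2 / s)) := by
      have : ContinuousAt (fun p : ℝ => 2 / (s * p)) 1 :=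
        ContinuousAt.div continuousAt_const (by fun_prop) (by simpa using hs0.ne')
      simpa using this.tendsto.mono_left (nhdsWithin_le_nhds (s := Ioi 1))
    have h3 := (h.const_mul 2).add hc
    have e2 : 4 / s = 2 * (1 / s) + 2 / s := by ring
    rw [e2]
    exact h3
end

section
/- Let N ≥ 1, p ∈ (1,∞) and s ∈ (0,1) with sp < 1. Then for every nonempty open set Ω ⊊ ℝ^N one has 𝔥_{s,p}(Ω) ≤ 𝔥_{sp,1}(Ω), and for Ω = ℍ^N_+ the inequality is strict: 𝔥_{s,p}(ℍ^N_+) < 𝔥_{sp,1}(ℍ^N_+). -/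
open MeasureTheory Metric Set Filter
open scoped ENNReal NNReal

/-- The `p`-th power of the Gagliardo `(s,p)`-seminorm of `u` on `A ⊆ ℝ^N`,
valued in `[0,∞]`. -/
noncomputable def gagliardo (N : ℕ) (s p : ℝ) (A : Set (EuclideanSpace ℝ (Fin N)))
    (u : EuclideanSpace ℝ (Fin N) → ℝ) : ℝ≥0∞ :=
  ∫⁻ x in A, ∫⁻ y in A, ENNReal.ofReal (|u x - u y| ^ p / dist x y ^ ((N : ℝ) + s * p))

/-- The sharp fractional Hardy constant `𝔥_{s,p}(Ω)`, an element of `[0,∞]`. -/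
noncomputable def hardyConst (N : ℕ) (s p : ℝ) (Ω : Set (EuclideanSpace ℝ (Fin N))) : ℝ≥0∞ :=
  sInf { c : ℝ≥0∞ | ∃ u : EuclideanSpace ℝ (Fin N) → ℝ,
    ContDiff ℝ (⊤ : ℕ∞) u ∧ HasCompactSupport u ∧ tsupport u ⊆ Ω ∧
    (∫ x in Ω, |u x| ^ p / Metric.infDist x (frontier Ω) ^ (s * p)) = 1 ∧
    c = gagliardo N s p Set.univ u }

/-- The half-space `ℍ^N₊ = (0,∞) × ℝ^{N-1}`. -/
noncomputable def halfSpace (N : ℕ) (hN : 0 < N) : Set (EuclideanSpace ℝ (Fin N)) :=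
  {x | 0 < x ⟨0, hN⟩}


lemma aux_rpow_diff {p : ℝ} (hp : 1 < p) {A B : ℝ} (hA : 0 ≤ A) (hB : 0 ≤ B) :
    |A ^ (1/p) - B ^ (1/p)| ^ p ≤ |A - B| := by
  have hp0 : 0 < p := by linarith
  wlog h : B ≤ A generalizing A B
  · rw [abs_sub_comm, abs_sub_comm A B]
    exact this hB hA (le_of_not_ge h)
  have h1 : B ^ (1/p) ≤ A ^ (1/p) := Real.rpow_le_rpow hB h (by positivity)
  rw [abs_of_nonneg (by linarith), abs_of_nonneg (by linarith)]
  have h2 := Real.add_rpow_le_rpow_add (p := p) (a := A ^ (1/p) - B ^ (1/p)) (b := B ^ (1/p))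
    (by linarith) (by positivity) hp.le
  rw [sub_add_cancel, ← Real.rpow_mul hB, ← Real.rpow_mul hA, one_div_mul_cancel hp0.ne',
    Real.rpow_one, Real.rpow_one] at h2
  linarith

lemma aux_sqrt_lip (e a b : ℝ) : |Real.sqrt (e^2 + a^2) - Real.sqrt (e^2 + b^2)| ≤ |a - b| := by
  have ha := Real.sq_sqrt (show 0 ≤ e^2 + a^2 by positivity)
  have hb := Real.sq_sqrt (show 0 ≤ e^2 + b^2 by positivity)
  have ha0 := Real.sqrt_nonneg (e^2 + a^2)
  have hb0 := Real.sqrt_nonneg (e^2 + b^2)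
  set A := Real.sqrt (e^2 + a^2)
  set B := Real.sqrt (e^2 + b^2)
  apply sq_le_sq.mp
  have : e^2 + a*b ≤ A * B := by
    refine (le_abs_self _).trans (abs_le_of_sq_le_sq ?_ (by positivity))
    rw [mul_pow, ha, hb]
    nlinarith [sq_nonneg (e*a - e*b)]
  nlinarith

lemma aux_hardy_mul_le (N : ℕ) (s p : ℝ) (hp : 0 < p) (Ω : Set (EuclideanSpace ℝ (Fin N)))
    (u : EuclideanSpace ℝ (Fin N) → ℝ) (hu : ContDiff ℝ (⊤ : ℕ∞) u) (hc : HasCompactSupport u)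
    (hs : tsupport u ⊆ Ω)
    (hI : ∫⁻ x in Ω, ENNReal.ofReal (|u x| ^ p / Metric.infDist x (frontier Ω) ^ (s * p)) ≠ ∞) :
    hardyConst N s p Ω *
      ∫⁻ x in Ω, ENNReal.ofReal (|u x| ^ p / Metric.infDist x (frontier Ω) ^ (s * p)) ≤
      gagliardo N s p Set.univ u := by
  set I := ∫⁻ x in Ω, ENNReal.ofReal (|u x| ^ p / Metric.infDist x (frontier Ω) ^ (s * p)) with hIdef
  by_cases h0 : I = 0
  · simp [h0]
  have ha : 0 < I.toReal := ENNReal.toReal_pos h0 hI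
  set a := I.toReal with hadef
  have hIa : I = ENNReal.ofReal a := (ENNReal.ofReal_toReal hI).symm
  set t : ℝ := a ^ (-(1/p)) with ht
  have ht0 : 0 < t := by positivity
  have htp : t ^ p = a⁻¹ := by
    rw [ht, ← Real.rpow_mul ha.le, neg_mul, one_div_mul_cancel hp.ne', Real.rpow_neg_one]
  have hmeas : Measurable u := hu.continuous.measurable
  have key : hardyConst N s p Ω ≤ ENNReal.ofReal a⁻¹ * gagliardo N s p Set.univ u := by
    apply sInf_le
    refine ⟨fun x => t * u x, contDiff_const.mul hu, hc.mul_left, ?_, ?_, ?_⟩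
    · refine subset_trans ?_ hs
      exact closure_mono (fun x hx => by
        simp only [Function.mem_support] at hx ⊢
        exact right_ne_zero_of_mul hx)
    · have : ∀ x, |t * u x| ^ p / Metric.infDist x (frontier Ω) ^ (s * p)
          = a⁻¹ * (|u x| ^ p / Metric.infDist x (frontier Ω) ^ (s * p)) := by
        intro x
        rw [abs_mul, Real.mul_rpow (abs_nonneg _) (abs_nonneg _), abs_of_pos ht0, htp]
        ring
      simp_rw [this]
      rw [integral_const_mul, integral_eq_lintegral_of_nonneg_ae]
      · exact inv_mul_cancel₀ ha.ne'
      · refine Filter.Eventually.of_forall fun x => ?_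
        have := Metric.infDist_nonneg (x := x) (s := frontier Ω)
        simp only [Pi.zero_apply]; positivity
      · have : Measurable (fun x => Metric.infDist x (frontier Ω)) :=
          (Metric.continuous_infDist_pt _).measurable
        apply Measurable.aestronglyMeasurable
        fun_prop
    · unfold gagliardo
      rw [← lintegral_const_mul']
      swap; · simp
      congr 1; ext x
      rw [← lintegral_const_mul']
      swap; · simp
      congr 1; ext y
      rw [← ENNReal.ofReal_mul (by positivity), ← mul_sub, abs_mul,
        Real.mul_rpow (abs_nonneg _) (abs_nonneg _), abs_of_pos ht0, htp]
      congr 1; ring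
  calc hardyConst N s p Ω * I ≤ (ENNReal.ofReal a⁻¹ * gagliardo N s p Set.univ u) * I := by gcongr
    _ = gagliardo N s p Set.univ u * (ENNReal.ofReal a⁻¹ * ENNReal.ofReal a) := by rw [hIa]; ring
    _ = _ := by
      rw [← ENNReal.ofReal_mul (by positivity), inv_mul_cancel₀ ha.ne']; simp

lemma aux_fatou {α : Type*} [MeasurableSpace α] (μ : Measure α) (F : α → ℝ≥0∞) (Fn : ℕ → α → ℝ≥0∞)
    (hm : ∀ n, AEMeasurable (Fn n) μ) (h G : ℝ≥0∞)
    (hlim : ∀ᵐ x ∂μ, Tendsto (fun n => Fn n x) atTop (nhds (F x)))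
    (hb : ∀ n, h * ∫⁻ x, Fn n x ∂μ ≤ G) : h * ∫⁻ x, F x ∂μ ≤ G := by
  by_cases h0 : h = 0
  · simp [h0]
  by_cases hG : G = ∞
  · simp [hG]
  rw [mul_comm, ← ENNReal.le_div_iff_mul_le (Or.inl h0) (Or.inr hG)]
  calc ∫⁻ x, F x ∂μ = ∫⁻ x, liminf (fun n => Fn n x) atTop ∂μ := by
        apply lintegral_congr_ae
        filter_upwards [hlim] with x hx using hx.liminf_eq.symm
    _ ≤ liminf (fun n => ∫⁻ x, Fn n x ∂μ) atTop := lintegral_liminf_le' hm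
    _ ≤ G / h := by
        refine liminf_le_of_frequently_le' (Frequently.of_forall fun n => ?_)
        rw [ENNReal.le_div_iff_mul_le (Or.inl h0) (Or.inr hG), mul_comm]
        exact hb n

lemma aux_part1 (N : ℕ) (s p : ℝ) (hp : 1 < p) (Ω : Set (EuclideanSpace ℝ (Fin N))) :
    hardyConst N s p Ω ≤ hardyConst N (s * p) 1 Ω := by
  have hp0 : 0 < p := by linarith
  apply le_sInf
  rintro c ⟨u, hu, hc, hs, hI, rfl⟩
  simp only [mul_one, Real.rpow_one] at hI
  have hint : Integrable (fun x => |u x| / Metric.infDist x (frontier Ω) ^ (s * p))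
      (volume.restrict Ω) := by
    by_contra h
    rw [integral_undef h] at hI
    exact zero_ne_one hI
  have hnn : ∀ x, 0 ≤ Metric.infDist x (frontier Ω) := fun x => Metric.infDist_nonneg
  have hI' : ∫⁻ x in Ω, ENNReal.ofReal (|u x| / Metric.infDist x (frontier Ω) ^ (s * p)) = 1 := by
    rw [← ofReal_integral_eq_lintegral_ofReal hint, hI, ENNReal.ofReal_one]
    refine Filter.Eventually.of_forall fun x => ?_
    have := hnn x
    simp only [Pi.zero_apply]; positivity
  let e : ℕ → ℝ := fun n => 1 / ((n : ℝ) + 1)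
  have he : ∀ n, 0 < e n := fun n => by positivity
  let v : ℕ → EuclideanSpace ℝ (Fin N) → ℝ := fun n x =>
    (Real.sqrt ((e n)^2 + (u x)^2)) ^ (1/p) - (e n) ^ (1/p)
  have hdiff : ∀ n x y, |v n x - v n y| ^ p ≤ |u x - u y| := by
    intro n x y
    simp only [v, sub_sub_sub_cancel_right]
    exact (aux_rpow_diff hp (Real.sqrt_nonneg _) (Real.sqrt_nonneg _)).trans (aux_sqrt_lip _ _ _)
  have hbd : ∀ n x, |v n x| ^ p ≤ |u x| := by
    intro n x
    refine (aux_rpow_diff hp (Real.sqrt_nonneg _) (he n).le).trans ?_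
    have := aux_sqrt_lip (e n) (u x) 0
    simpa [Real.sqrt_sq (he n).le] using this
  have hv0 : ∀ n x, u x = 0 → v n x = 0 := by
    intro n x h
    simp [v, h, Real.sqrt_sq (he n).le]
  have hvs : ∀ n, Function.support (v n) ⊆ Function.support u := fun n x hx h => hx (hv0 n x h)
  have hvsm : ∀ n, ContDiff ℝ (⊤ : ℕ∞) (v n) := by
    intro n
    have hpos : ∀ x, (e n)^2 + (u x)^2 ≠ 0 := fun x => by have := he n; positivity
    refine ContDiff.sub (ContDiff.rpow_const_of_ne (ContDiff.sqrt ?_ hpos) ?_) contDiff_const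
    · exact contDiff_const.add (hu.pow 2)
    · intro x
      have := he n
      exact (Real.sqrt_pos.2 (by positivity)).ne'
  have hmeas : Measurable u := hu.continuous.measurable
  have hmd : Measurable (fun x => Metric.infDist x (frontier Ω)) :=
          (Metric.continuous_infDist_pt _).measurable
  have hmv : ∀ n, Measurable (v n) := fun n => (hvsm n).continuous.measurable
  have := aux_fatou (volume.restrict Ω)
    (fun x => ENNReal.ofReal (|u x| / Metric.infDist x (frontier Ω) ^ (s * p)))
    (fun n x => ENNReal.ofReal (|v n x| ^ p / Metric.infDist x (frontier Ω) ^ (s * p)))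
    (fun n => by have := hmv n; apply Measurable.aemeasurable; fun_prop) (hardyConst N s p Ω)
    (gagliardo N (s * p) 1 Set.univ u) ?_ ?_
  · rwa [hI', mul_one] at this
  · refine Filter.Eventually.of_forall fun x => ?_
    apply ENNReal.tendsto_ofReal
    apply Tendsto.div_const
    have hcont : Continuous (fun r : ℝ => |(Real.sqrt (r^2 + (u x)^2)) ^ (1/p) - r ^ (1/p)| ^ p) := by
      refine Continuous.rpow_const (Continuous.abs (Continuous.sub ?_ ?_)) (fun _ => Or.inr hp0.le)
      · refine Continuous.rpow_const (by fun_prop) (fun _ => Or.inr (by positivity))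
      · exact Continuous.rpow_const (by fun_prop) (fun _ => Or.inr (by positivity))
    have h1 := (hcont.tendsto 0).comp tendsto_one_div_add_atTop_nhds_zero_nat
    have h2 : |(Real.sqrt ((0:ℝ)^2 + (u x)^2)) ^ (1/p) - (0:ℝ) ^ (1/p)| ^ p = |u x| := by
      rw [Real.zero_rpow (by positivity), sub_zero, abs_of_nonneg (by positivity),
        ← Real.rpow_mul (by positivity), one_div_mul_cancel hp0.ne', Real.rpow_one]
      simp [Real.sqrt_sq_eq_abs]
    rw [h2] at h1
    exact h1
  · intro n
    refine (aux_hardy_mul_le N s p hp0 Ω (v n) (hvsm n) (hc.mono (hvs n))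
      ((closure_mono (hvs n)).trans hs) ?_).trans ?_
    · refine ne_of_lt (lt_of_le_of_lt (lintegral_mono fun x => ?_)
        (hI'.trans_lt ENNReal.one_lt_top))
      have := hnn x
      have := hbd n x
      apply ENNReal.ofReal_le_ofReal
      gcongr
    · unfold gagliardo
      refine lintegral_mono fun x => lintegral_mono fun y => ENNReal.ofReal_le_ofReal ?_
      rw [mul_one, Real.rpow_one]
      have := hdiff n x y
      gcongr

/-- Riesz-type kernel. -/
noncomputable def auxK (N : ℕ) (σ : ℝ) (z : EuclideanSpace ℝ (Fin N)) : ℝ≥0∞ :=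
  ENNReal.ofReal (1 / ‖z‖ ^ ((N : ℝ) + σ))

lemma auxK_meas (N : ℕ) (σ : ℝ) : Measurable (auxK N σ) := by
  unfold auxK; fun_prop

lemma auxK_neg (N : ℕ) (σ : ℝ) (z : EuclideanSpace ℝ (Fin N)) : auxK N σ (-z) = auxK N σ z := by
  simp [auxK]

lemma aux_gag_eq (N : ℕ) (s p : ℝ) (u : EuclideanSpace ℝ (Fin N) → ℝ) (hu : Measurable u) :
    gagliardo N s p Set.univ u =
      ∫⁻ z, auxK N (s * p) z * ∫⁻ x, ENNReal.ofReal (|u x - u (x + z)| ^ p) := by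
  have hK := auxK_meas N (s * p)
  unfold gagliardo
  simp only [Measure.restrict_univ]
  have h1 : ∀ x, ∫⁻ y, ENNReal.ofReal (|u x - u y| ^ p / dist x y ^ ((N : ℝ) + s * p)) =
      ∫⁻ z, auxK N (s * p) z * ENNReal.ofReal (|u x - u (x + z)| ^ p) := by
    intro x
    rw [← lintegral_add_left_eq_self _ x]
    congr 1; ext z
    unfold auxK
    rw [← ENNReal.ofReal_mul (by positivity)]
    congr 1
    simp only [dist_self_add_right]
    ring
  simp_rw [h1]
  rw [lintegral_lintegral_swap]
  · congr 1; ext z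
    rw [lintegral_const_mul]
    fun_prop
  · apply Measurable.aemeasurable
    fun_prop

lemma auxK_int (N : ℕ) (hN : 0 < N) (σ : ℝ) (h0 : 0 < σ) (h1 : σ < 1) :
    ∫⁻ z : EuclideanSpace ℝ (Fin N), auxK N σ z * ENNReal.ofReal (min 1 ‖z‖) ≠ ∞ := by
  have : Nonempty (Fin N) := ⟨⟨0, hN⟩⟩
  have : Nontrivial (EuclideanSpace ℝ (Fin N)) := inferInstance
  have hint : Integrable (fun z : EuclideanSpace ℝ (Fin N) =>
      (fun r : ℝ => 1 / r ^ ((N : ℝ) + σ) * min 1 r) ‖z‖) := by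
    refine (integrable_fun_norm_addHaar volume
      (f := fun r : ℝ => 1 / r ^ ((N : ℝ) + σ) * min 1 r)).2 ?_
    rw [finrank_euclideanSpace_fin, ← Ioc_union_Ioi_eq_Ioi (zero_le_one (α := ℝ))]
    have hpw : ∀ r : ℝ, 0 < r → r ^ (N - 1) * (1 / r ^ ((N : ℝ) + σ)) = r ^ (-1 - σ) := by
      intro r hr
      rw [← Real.rpow_natCast, one_div, ← Real.rpow_neg hr.le, ← Real.rpow_add hr,
        Nat.cast_sub (by omega)]
      congr 1
      push_cast; ring
    refine IntegrableOn.union ?_ ?_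
    · have h2 : IntegrableOn (fun r : ℝ => r ^ (-σ)) (Ioc 0 1) := by
        have := intervalIntegral.intervalIntegrable_rpow' (a := 0) (b := 1) (r := -σ) (by linarith)
        rwa [intervalIntegrable_iff_integrableOn_Ioc_of_le zero_le_one] at this
      refine h2.congr_fun (fun r hr => ?_) measurableSet_Ioc
      simp only [smul_eq_mul]
      rw [← mul_assoc, hpw r hr.1, min_eq_right hr.2, ← Real.rpow_add_one hr.1.ne']
      congr 1; ring
    · have h2 : IntegrableOn (fun r : ℝ => r ^ (-1 - σ)) (Ioi 1) :=
        integrableOn_Ioi_rpow_of_lt (by linarith) one_pos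
      refine h2.congr_fun (fun r hr => ?_) measurableSet_Ioi
      have hr0 : (0:ℝ) < r := lt_trans one_pos hr
      simp only [smul_eq_mul]
      rw [← mul_assoc, hpw r hr0, min_eq_left (le_of_lt hr), mul_one]
  have := hint.lintegral_lt_top
  refine ne_of_lt (lt_of_le_of_lt (le_of_eq ?_) this)
  congr 1; ext z
  unfold auxK
  rw [← ENNReal.ofReal_mul (by positivity)]

lemma auxK_scale (N : ℕ) (hN : 0 < N) (σ : ℝ) (t : ℝ) (ht : 0 < t) :
    ∫⁻ z in {z : EuclideanSpace ℝ (Fin N) | t ≤ |z ⟨0, hN⟩|}, auxK N σ z =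
      (∫⁻ z in {z : EuclideanSpace ℝ (Fin N) | 1 ≤ |z ⟨0, hN⟩|}, auxK N σ z) *
        ENNReal.ofReal (1 / t ^ σ) := by
  have hK := auxK_meas N σ
  have hms : ∀ r : ℝ, MeasurableSet {z : EuclideanSpace ℝ (Fin N) | r ≤ |z ⟨0, hN⟩|} := by
    intro r
    apply measurableSet_le <;> fun_prop
  rw [← lintegral_indicator (hms t), ← lintegral_indicator (hms 1)]
  have hmap := Measure.map_addHaar_smul (volume : Measure (EuclideanSpace ℝ (Fin N))) ht.ne'
  set F := ({z : EuclideanSpace ℝ (Fin N) | t ≤ |z ⟨0, hN⟩|}).indicator (fun z => auxK N σ z) with hF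
  have hFm : Measurable F := hK.indicator (hms t)
  have h1 : ∫⁻ z, F (t • z) = ENNReal.ofReal |(t ^ N)⁻¹| * ∫⁻ z, F z := by
    have : ∫⁻ z, F (t • z) = ∫⁻ z, F z ∂(Measure.map (fun x => t • x) volume) :=
      (lintegral_map hFm (measurable_const_smul t)).symm
    rw [this, hmap, lintegral_smul_measure, finrank_euclideanSpace_fin, smul_eq_mul]
  have h2 : ∀ z, F (t • z) = ENNReal.ofReal (1 / t ^ ((N:ℝ) + σ)) *
      ({z : EuclideanSpace ℝ (Fin N) | 1 ≤ |z ⟨0, hN⟩|}).indicator (fun z => auxK N σ z) z := by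
    intro z
    simp only [hF, indicator_apply, mem_ofPred_eq, PiLp.smul_apply, smul_eq_mul, abs_mul,
      abs_of_pos ht]
    have : t ≤ t * |z ⟨0, hN⟩| ↔ 1 ≤ |z ⟨0, hN⟩| := by
      constructor
      · intro h; by_contra h'; push Not at h'; nlinarith
      · intro h; nlinarith
    simp only [this]
    split_ifs
    · unfold auxK
      rw [← ENNReal.ofReal_mul (by positivity), norm_smul, Real.norm_eq_abs, abs_of_pos ht,
        Real.mul_rpow ht.le (norm_nonneg _)]
      congr 1
      rw [div_mul_div_comm, one_mul]
    · simp
  simp_rw [h2] at h1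
  rw [lintegral_const_mul _ (hK.indicator (hms 1))] at h1
  have h3 : ENNReal.ofReal (t ^ N) * (ENNReal.ofReal |(t ^ N)⁻¹| * ∫⁻ z, F z) = ∫⁻ z, F z := by
    rw [← mul_assoc, ← ENNReal.ofReal_mul (by positivity), abs_of_pos (by positivity),
      mul_inv_cancel₀ (by positivity)]
    simp
  rw [← h3, ← h1, ← mul_assoc, ← ENNReal.ofReal_mul (by positivity), mul_comm]
  congr 2
  rw [Real.rpow_add ht, Real.rpow_natCast]
  field_simp

lemma auxK_C_fin (N : ℕ) (hN : 0 < N) (σ : ℝ) (h0 : 0 < σ) (h1 : σ < 1) :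
    (∫⁻ z in {z : EuclideanSpace ℝ (Fin N) | 1 ≤ |z ⟨0, hN⟩|}, auxK N σ z) ≠ ∞ := by
  refine ne_of_lt (lt_of_le_of_lt ?_ (lt_top_iff_ne_top.2 (auxK_int N hN σ h0 h1)))
  refine le_trans ?_ (setLIntegral_le_lintegral {z : EuclideanSpace ℝ (Fin N) | 1 ≤ |z ⟨0, hN⟩|} _)
  refine setLIntegral_mono' (measurableSet_le (by fun_prop) (by fun_prop)) fun z hz => ?_
  have : 1 ≤ ‖z‖ := le_trans hz (PiLp.norm_apply_le z ⟨0, hN⟩)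
  rw [min_eq_left this]; simp

lemma aux_infDist (N : ℕ) (hN : 0 < N) (x : EuclideanSpace ℝ (Fin N)) (hx : x ∈ halfSpace N hN) :
    Metric.infDist x (frontier (halfSpace N hN)) = x ⟨0, hN⟩ := by
  have hfr : frontier (halfSpace N hN) = {y : EuclideanSpace ℝ (Fin N) | y ⟨0, hN⟩ = 0} := by
    have hop : IsOpenMap (EuclideanSpace.proj ⟨0, hN⟩ : EuclideanSpace ℝ (Fin N) →L[ℝ] ℝ) := by
      apply ContinuousLinearMap.isOpenMap
      intro r
      exact ⟨EuclideanSpace.single ⟨0, hN⟩ r, by simp⟩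
    have := hop.preimage_frontier_eq_frontier_preimage (ContinuousLinearMap.continuous _) (Ioi (0:ℝ))
    rw [frontier_Ioi] at this
    exact this.symm
  rw [hfr]
  have hx0 : 0 < x ⟨0, hN⟩ := hx
  set y : EuclideanSpace ℝ (Fin N) := x - EuclideanSpace.single ⟨0, hN⟩ (x ⟨0, hN⟩) with hy
  have hyS : y ∈ {y : EuclideanSpace ℝ (Fin N) | y ⟨0, hN⟩ = 0} := by
    change y ⟨0, hN⟩ = 0
    simp [hy]
  apply le_antisymm
  · refine (Metric.infDist_le_dist_of_mem hyS).trans ?_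
    rw [dist_eq_norm, hy]
    simp [abs_of_pos hx0]
  · rw [Metric.le_infDist ⟨y, hyS⟩]
    intro w hw
    have hw0 : w ⟨0, hN⟩ = 0 := hw
    have := PiLp.norm_apply_le (x - w) ⟨0, hN⟩
    rw [dist_eq_norm]
    simpa [hw0, abs_of_pos hx0] using this

lemma aux_measH (N : ℕ) (hN : 0 < N) : MeasurableSet (halfSpace N hN) := by
  unfold halfSpace
  exact measurableSet_lt (by fun_prop) (by fun_prop)

/-- the key one-direction estimate. -/
lemma aux_phi_pos (N : ℕ) (hN : 0 < N) (u : EuclideanSpace ℝ (Fin N) → ℝ) (hu : Measurable u)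
    (hsupp : ∀ x, x ∉ halfSpace N hN → u x = 0)
    (hfin : ∫⁻ x, ENNReal.ofReal |u x| ≠ ∞) (z : EuclideanSpace ℝ (Fin N)) (hz : 0 ≤ z ⟨0, hN⟩) :
    2 * ∫⁻ x in {x | x ⟨0, hN⟩ ≤ z ⟨0, hN⟩}, ENNReal.ofReal |u x| ≤
      ∫⁻ x, ENNReal.ofReal |u x - u (x + z)| := by
  have hms : ∀ r : ℝ, MeasurableSet {x : EuclideanSpace ℝ (Fin N) | x ⟨0, hN⟩ ≤ r} := by
    intro r
    apply measurableSet_le <;> fun_prop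
  have htr : ∀ S : Set (EuclideanSpace ℝ (Fin N)), MeasurableSet S →
      ∫⁻ x in {x | x + z ∈ S}, ENNReal.ofReal |u (x + z)| = ∫⁻ x in S, ENNReal.ofReal |u x| := by
    intro S hS
    rw [← lintegral_indicator hS,
      ← lintegral_add_right_eq_self (S.indicator fun x => ENNReal.ofReal |u x|) z,
      ← lintegral_indicator (show MeasurableSet {x | x + z ∈ S} from (measurable_add_const z) hS)]
    rfl
  set A := ∫⁻ x in {x | x ⟨0, hN⟩ ≤ z ⟨0, hN⟩}, ENNReal.ofReal |u x| with hA
  have hH : {x : EuclideanSpace ℝ (Fin N) | x ⟨0, hN⟩ ≤ 0} =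
      {x | x + z ∈ {x : EuclideanSpace ℝ (Fin N) | x ⟨0, hN⟩ ≤ z ⟨0, hN⟩}} := by
    ext x; simp
  have hHc : {x : EuclideanSpace ℝ (Fin N) | x ⟨0, hN⟩ ≤ 0}ᶜ =
      {x | x + z ∈ {x : EuclideanSpace ℝ (Fin N) | x ⟨0, hN⟩ ≤ z ⟨0, hN⟩}ᶜ} := by
    ext x; simp
  rw [← lintegral_add_compl _ (hms 0), two_mul]
  have hu0 : ∀ x : EuclideanSpace ℝ (Fin N), x ⟨0, hN⟩ ≤ 0 → u x = 0 := by
    intro x hx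
    exact hsupp x (not_lt.2 hx)
  apply add_le_add
  · rw [hA, ← htr _ (hms _), ← hH]
    refine setLIntegral_mono' (hms 0) fun x hx => ?_
    rw [hu0 x hx, zero_sub, abs_neg]
  · have hB := htr _ (hms (z ⟨0, hN⟩)).compl
    rw [← hHc] at hB
    set B := ∫⁻ x in {x | x ⟨0, hN⟩ ≤ z ⟨0, hN⟩}ᶜ, ENNReal.ofReal |u x| with hBdef
    have hBfin : B ≠ ∞ := ne_of_lt (lt_of_le_of_lt (setLIntegral_le_lintegral _ _)
      (lt_top_iff_ne_top.2 hfin))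
    refine (ENNReal.add_le_add_iff_right hBfin).1 ?_
    rw [hA, hBdef, lintegral_add_compl _ (hms _), ← hBdef, ← hB,
      ← lintegral_add_compl (fun x => ENNReal.ofReal |u x|) (hms 0)]
    rw [setLIntegral_congr_fun (g := fun _ => 0) (hms 0) (fun x hx => by simp [hu0 x hx])]
    rw [lintegral_zero, zero_add, ← lintegral_add_left (by fun_prop)]
    refine lintegral_mono fun x => ?_
    rw [← ENNReal.ofReal_add (abs_nonneg _) (abs_nonneg _)]
    apply ENNReal.ofReal_le_ofReal
    have := abs_add_le (u x - u (x + z)) (u (x + z))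
    simpa using this

lemma aux_phi (N : ℕ) (hN : 0 < N) (u : EuclideanSpace ℝ (Fin N) → ℝ) (hu : Measurable u)
    (hsupp : ∀ x, x ∉ halfSpace N hN → u x = 0)
    (hfin : ∫⁻ x, ENNReal.ofReal |u x| ≠ ∞) (z : EuclideanSpace ℝ (Fin N)) :
    2 * ∫⁻ x in {x | x ⟨0, hN⟩ ≤ |z ⟨0, hN⟩|}, ENNReal.ofReal |u x| ≤
      ∫⁻ x, ENNReal.ofReal |u x - u (x + z)| := by
  rcases le_total 0 (z ⟨0, hN⟩) with h | h
  · rw [abs_of_nonneg h]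
    exact aux_phi_pos N hN u hu hsupp hfin z h
  · rw [abs_of_nonpos h]
    have := aux_phi_pos N hN u hu hsupp hfin (-z) (by simpa using h)
    rw [← lintegral_add_right_eq_self (fun x => ENNReal.ofReal |u x - u (x + -z)|) z] at this
    simp only [add_neg_cancel_right] at this
    simp_rw [abs_sub_comm (u (_ + z))] at this
    exact this

lemma aux_swap (N : ℕ) (hN : 0 < N) (σ : ℝ) (f : EuclideanSpace ℝ (Fin N) → ℝ≥0∞)
    (hf : Measurable f) (hsupp : ∀ x, x ∉ halfSpace N hN → f x = 0) :
    ∫⁻ z, auxK N σ z * ∫⁻ x in {x | x ⟨0, hN⟩ ≤ |z ⟨0, hN⟩|}, f x =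
     (∫⁻ z in {z : EuclideanSpace ℝ (Fin N) | 1 ≤ |z ⟨0, hN⟩|}, auxK N σ z) *
       ∫⁻ x in halfSpace N hN, f x * ENNReal.ofReal (1 / (x ⟨0, hN⟩) ^ σ) := by
  have hK := auxK_meas N σ
  have hmsx : ∀ r : ℝ, MeasurableSet {x : EuclideanSpace ℝ (Fin N) | x ⟨0, hN⟩ ≤ r} := by
    intro r
    apply measurableSet_le <;> fun_prop
  have hmsz : ∀ r : ℝ, MeasurableSet {z : EuclideanSpace ℝ (Fin N) | r ≤ |z ⟨0, hN⟩|} := by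
    intro r
    apply measurableSet_le <;> fun_prop
  have h1 : ∀ z : EuclideanSpace ℝ (Fin N),
      auxK N σ z * ∫⁻ x in {x | x ⟨0, hN⟩ ≤ |z ⟨0, hN⟩|}, f x =
      ∫⁻ x, (if x ⟨0, hN⟩ ≤ |z ⟨0, hN⟩| then f x * auxK N σ z else 0) := by
    intro z
    rw [← lintegral_indicator (hmsx _), ← lintegral_const_mul _ (hf.indicator (hmsx _))]
    congr 1; ext x
    simp only [indicator_apply, mem_ofPred_eq]
    split_ifs
    · ring
    · simp
  simp_rw [h1]
  rw [lintegral_lintegral_swap]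
  · rw [← lintegral_const_mul _ (by fun_prop), ← lintegral_indicator (aux_measH N hN)]
    congr 1; ext x
    by_cases hx : x ∈ halfSpace N hN
    · rw [indicator_of_mem hx]
      have := auxK_scale N hN σ (x ⟨0, hN⟩) hx
      rw [mul_left_comm, ← this, ← lintegral_indicator (hmsz _),
        ← lintegral_const_mul _ (hK.indicator (hmsz _))]
      congr 1; ext z
      simp only [indicator_apply, mem_ofPred_eq]
      split_ifs <;> simp
    · simp [hsupp x hx, hx]
  · apply Measurable.aemeasurable
    unfold Function.uncurry
    apply Measurable.ite
    · apply measurableSet_le <;> fun_prop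
    · fun_prop
    · fun_prop

lemma aux_lower (N : ℕ) (hN : 0 < N) (σ : ℝ) :
    2 * (∫⁻ z in {z : EuclideanSpace ℝ (Fin N) | 1 ≤ |z ⟨0, hN⟩|}, auxK N σ z) ≤
      hardyConst N σ 1 (halfSpace N hN) := by
  apply le_sInf
  rintro c ⟨u, hu, hc, hs, hI, rfl⟩
  simp only [mul_one, Real.rpow_one] at hI
  have hmeas : Measurable u := hu.continuous.measurable
  have hint : Integrable (fun x => |u x| / Metric.infDist x (frontier (halfSpace N hN)) ^ σ)
      (volume.restrict (halfSpace N hN)) := by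
    by_contra h
    rw [integral_undef h] at hI
    exact zero_ne_one hI
  have hnn : ∀ x, 0 ≤ Metric.infDist x (frontier (halfSpace N hN)) := fun x => Metric.infDist_nonneg
  have hI' : ∫⁻ x in halfSpace N hN,
      ENNReal.ofReal |u x| * ENNReal.ofReal (1 / (x ⟨0, hN⟩) ^ σ) = 1 := by
    have : ∫⁻ x in halfSpace N hN, ENNReal.ofReal (|u x| /
        Metric.infDist x (frontier (halfSpace N hN)) ^ σ) = 1 := by
      rw [← ofReal_integral_eq_lintegral_ofReal hint, hI, ENNReal.ofReal_one]
      refine Filter.Eventually.of_forall fun x => ?_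
      have := hnn x
      simp only [Pi.zero_apply]; positivity
    rw [← this]
    refine setLIntegral_congr_fun (aux_measH N hN) fun x hx => ?_
    simp only
    rw [aux_infDist N hN x hx, ← ENNReal.ofReal_mul (abs_nonneg _), mul_one_div]
  have hsupp : ∀ x, x ∉ halfSpace N hN → u x = 0 := by
    intro x hx
    by_contra h
    exact hx (hs (subset_tsupport u h))
  have hfin : ∫⁻ x, ENNReal.ofReal |u x| ≠ ∞ := by
    have := (hu.continuous.integrable_of_hasCompactSupport hc (μ := volume)).abs.lintegral_lt_top
    exact this.ne
  rw [aux_gag_eq N σ 1 u hmeas]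
  simp only [mul_one, Real.rpow_one]
  have := aux_swap N hN σ (fun x => ENNReal.ofReal |u x|) (by fun_prop)
    (fun x hx => by simp [hsupp x hx])
  rw [hI', mul_one] at this
  rw [← this]
  rw [← lintegral_const_mul' _ _ (by simp)]
  refine lintegral_mono fun z => ?_
  rw [mul_left_comm]
  gcongr
  exact aux_phi N hN u hmeas hsupp hfin z

lemma aux_jensen {α : Type*} [MeasurableSpace α] (μ : Measure α) (ρ h : α → ℝ) (hρ : Measurable ρ)
    (hh : Measurable h) (hρ0 : ∀ t, 0 ≤ ρ t) (hρ1 : ∫⁻ t, ENNReal.ofReal (ρ t) ∂μ = 1)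
    (p : ℝ) (hp : 1 ≤ p) :
    ENNReal.ofReal (|∫ t, ρ t * h t ∂μ| ^ p) ≤
      ∫⁻ t, ENNReal.ofReal (ρ t) * ENNReal.ofReal (|h t| ^ p) ∂μ := by
  have hp0 : 0 < p := by linarith
  let ν := μ.withDensity (fun t => ENNReal.ofReal (ρ t))
  have : IsProbabilityMeasure ν := ⟨by simp [ν, hρ1]⟩
  have hρm : Measurable (fun t => ENNReal.ofReal (ρ t)) := by fun_prop
  have h1 := eLpNorm'_le_eLpNorm'_of_exponent_le one_pos hp ν
    (hh.aestronglyMeasurable (μ := ν))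
  simp only [eLpNorm', ENNReal.rpow_one, one_div, inv_one] at h1
  rw [ENNReal.le_rpow_inv_iff hp0] at h1
  have h2 : ∫⁻ t, ‖h t‖ₑ ∂ν = ∫⁻ t, ENNReal.ofReal (ρ t) * ‖h t‖ₑ ∂μ :=
    lintegral_withDensity_eq_lintegral_mul _ hρm (by fun_prop)
  have h3 : ∫⁻ t, ‖h t‖ₑ ^ p ∂ν = ∫⁻ t, ENNReal.ofReal (ρ t) * ‖h t‖ₑ ^ p ∂μ :=
    lintegral_withDensity_eq_lintegral_mul _ hρm (by fun_prop)
  rw [h2, h3] at h1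
  have h4 : ENNReal.ofReal (|∫ t, ρ t * h t ∂μ| ^ p) = ‖∫ t, ρ t * h t ∂μ‖ₑ ^ p := by
    rw [← ENNReal.ofReal_rpow_of_nonneg (abs_nonneg _) hp0.le, Real.enorm_eq_ofReal_abs]
  rw [h4]
  have h5 : ‖∫ t, ρ t * h t ∂μ‖ₑ ≤ ∫⁻ t, ENNReal.ofReal (ρ t) * ‖h t‖ₑ ∂μ := by
    refine (enorm_integral_le_lintegral_enorm _).trans (le_of_eq ?_)
    congr 1; ext t
    rw [enorm_mul, Real.enorm_of_nonneg (hρ0 t)]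
  calc _ ≤ _ := ENNReal.rpow_le_rpow h5 hp0.le
    _ ≤ _ := h1
    _ = _ := by
      congr 1; ext t
      rw [← ENNReal.ofReal_rpow_of_nonneg (abs_nonneg _) hp0.le, Real.enorm_eq_ofReal_abs]

lemma aux_moll (N : ℕ) (hN : 0 < N) (s p : ℝ) (hp : 1 < p) (hs : 0 < s)
    (v : EuclideanSpace ℝ (Fin N) → ℝ) (hv : Measurable v) (hint : Integrable v)
    (hc : HasCompactSupport v) (hsupp : ∀ x, x ∉ halfSpace N hN → v x = 0) :
    hardyConst N s p (halfSpace N hN) *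
      ∫⁻ x in halfSpace N hN, ENNReal.ofReal (|v x| ^ p / x ⟨0, hN⟩ ^ (s * p)) ≤
      gagliardo N s p Set.univ v := by
  have hp0 : 0 < p := by linarith
  have hsp0 : 0 < s * p := by positivity
  let r : ℕ → ℝ := fun n => 1 / ((n : ℝ) + 1)
  have hr : ∀ n, 0 < r n := fun n => by positivity
  let B : ℕ → ContDiffBump (0 : EuclideanSpace ℝ (Fin N)) := fun n =>
    ⟨r n / 2, r n, by have := hr n; positivity, by have := hr n; linarith⟩
  let ρ : ℕ → EuclideanSpace ℝ (Fin N) → ℝ := fun n => (B n).normed volume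
  let w : ℕ → EuclideanSpace ℝ (Fin N) → ℝ := fun n =>
    convolution (ρ n) v (ContinuousLinearMap.lsmul ℝ ℝ) volume
  have hρc : ∀ n, HasCompactSupport (ρ n) := fun n => (B n).hasCompactSupport_normed
  have hρs : ∀ n, ContDiff ℝ (⊤ : ℕ∞) (ρ n) := fun n => (B n).contDiff_normed
  have hρm : ∀ n, Measurable (ρ n) := fun n => (hρs n).continuous.measurable
  have hρ0 : ∀ n t, 0 ≤ ρ n t := fun n t => (B n).nonneg_normed t
  have hρ1 : ∀ n, ∫⁻ t, ENNReal.ofReal (ρ n t) = 1 := by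
    intro n
    rw [← ofReal_integral_eq_lintegral_ofReal ((B n).integrable_normed)
      (Filter.Eventually.of_forall (hρ0 n)), (B n).integral_normed, ENNReal.ofReal_one]
  have hws : ∀ n, ContDiff ℝ (⊤ : ℕ∞) (w n) := fun n =>
    (hρc n).contDiff_convolution_left _ (hρs n) hint.locallyIntegrable
  have hwc : ∀ n, HasCompactSupport (w n) := fun n => (hρc n).convolution _ hc
  have hwm : ∀ n, Measurable (w n) := fun n => (hws n).continuous.measurable
  have hw0 : ∀ n x, w n x ≠ 0 → - r n < x ⟨0, hN⟩ := by
    intro n x hx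
    have h1 := support_convolution_subset (ContinuousLinearMap.lsmul ℝ ℝ)
      (μ := (volume : Measure (EuclideanSpace ℝ (Fin N)))) (f := ρ n) (g := v)
      (show x ∈ Function.support _ from hx)
    obtain ⟨a, ha, b, hb, rfl⟩ := h1
    rw [(B n).support_normed_eq] at ha
    have ha' : ‖a‖ < r n := by simpa [B] using ha
    have hb' : 0 < b ⟨0, hN⟩ := by
      by_contra h
      exact hb (hsupp b h)
    have := PiLp.norm_apply_le a ⟨0, hN⟩
    have h3 := neg_abs_le (a ⟨0, hN⟩)
    simp only [Real.norm_eq_abs] at this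
    simp only [PiLp.add_apply]
    linarith
  let e : EuclideanSpace ℝ (Fin N) := EuclideanSpace.single ⟨0, hN⟩ 1
  let d : ℕ → EuclideanSpace ℝ (Fin N) := fun n => (2 * r n) • e
  have hd0 : ∀ n, d n ⟨0, hN⟩ = 2 * r n := by intro n; simp [d, e]
  let V : ℕ → EuclideanSpace ℝ (Fin N) → ℝ := fun n x => w n (x - d n)
  have hVs : ∀ n, ContDiff ℝ (⊤ : ℕ∞) (V n) := fun n =>
    (hws n).comp (contDiff_id.sub contDiff_const)
  have hVc : ∀ n, HasCompactSupport (V n) := fun n =>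
    (hwc n).comp_homeomorph (Homeomorph.subRight (d n))
  have hVm : ∀ n, Measurable (V n) := fun n => (hVs n).continuous.measurable
  have hV0 : ∀ n x, V n x ≠ 0 → r n < x ⟨0, hN⟩ := by
    intro n x hx
    have := hw0 n _ hx
    simp only [PiLp.sub_apply, hd0] at this
    linarith
  have hVt : ∀ n, tsupport (V n) ⊆ halfSpace N hN := by
    intro n
    have hcl : IsClosed {x : EuclideanSpace ℝ (Fin N) | r n ≤ x ⟨0, hN⟩} :=
      isClosed_le (by fun_prop) (by fun_prop)
    refine (closure_minimal (fun x hx => (hV0 n x hx).le) hcl).trans (fun x hx => ?_)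
    exact lt_of_lt_of_le (hr n) hx
  have hphi : ∀ n z, ∫⁻ x, ENNReal.ofReal (|V n x - V n (x + z)| ^ p) ≤
      ∫⁻ x, ENNReal.ofReal (|v x - v (x + z)| ^ p) := by
    intro n z
    have h1 : ∫⁻ x, ENNReal.ofReal (|V n x - V n (x + z)| ^ p) =
        ∫⁻ x, ENNReal.ofReal (|w n x - w n (x + z)| ^ p) := by
      rw [← lintegral_sub_right_eq_self (fun x => ENNReal.ofReal (|w n x - w n (x + z)| ^ p)) (d n)]
      simp only [V]
      congr 1; ext x
      rw [add_sub_right_comm]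
    rw [h1]
    have h2 : ∀ x, w n x - w n (x + z) = ∫ t, ρ n t * (v (x - t) - v (x - t + z)) := by
      intro x
      have e1 := (hρc n).convolutionExists_left (ContinuousLinearMap.lsmul ℝ ℝ)
        (hρs n).continuous hint.locallyIntegrable
      simp only [w, convolution]
      rw [← integral_sub (e1 x) (e1 (x + z))]
      congr 1; ext t
      simp only [ContinuousLinearMap.lsmul_apply, smul_eq_mul]
      rw [mul_sub, add_sub_right_comm]
    calc ∫⁻ x, ENNReal.ofReal (|w n x - w n (x + z)| ^ p)
        ≤ ∫⁻ x, ∫⁻ t, ENNReal.ofReal (ρ n t) *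
            ENNReal.ofReal (|v (x - t) - v (x - t + z)| ^ p) := by
          refine lintegral_mono fun x => ?_
          simp only [h2]
          exact aux_jensen volume (ρ n) (fun t => v (x - t) - v (x - t + z)) (hρm n)
            (by fun_prop) (hρ0 n) (hρ1 n) p hp.le
      _ = ∫⁻ t, ∫⁻ x, ENNReal.ofReal (ρ n t) *
            ENNReal.ofReal (|v (x - t) - v (x - t + z)| ^ p) := by
          have := hρm n
          rw [lintegral_lintegral_swap]
          apply Measurable.aemeasurable
          fun_prop
      _ = ∫⁻ t, ENNReal.ofReal (ρ n t) * ∫⁻ x, ENNReal.ofReal (|v x - v (x + z)| ^ p) := by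
          congr 1; ext t
          rw [lintegral_const_mul _ (by fun_prop),
            lintegral_sub_right_eq_self (fun x => ENNReal.ofReal (|v x - v (x + z)| ^ p)) t]
      _ = _ := by
          rw [lintegral_mul_const _ (by have := hρm n; fun_prop), hρ1, one_mul]
  have hgag : ∀ n, gagliardo N s p Set.univ (V n) ≤ gagliardo N s p Set.univ v := by
    intro n
    rw [aux_gag_eq N s p _ (hVm n), aux_gag_eq N s p _ hv]
    refine lintegral_mono fun z => ?_
    exact mul_le_mul' le_rfl (hphi n z)
  refine aux_fatou (volume.restrict (halfSpace N hN)) _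
    (fun n y => ENNReal.ofReal (|w n y| ^ p / (y ⟨0, hN⟩ + 2 * r n) ^ (s * p)))
    (fun n => by have := hwm n; apply Measurable.aemeasurable; fun_prop) _ _ ?_ ?_
  · have hr0 : Tendsto r atTop (nhds 0) := tendsto_one_div_add_atTop_nhds_zero_nat
    have h1 := ContDiffBump.ae_convolution_tendsto_right_of_locallyIntegrable (φ := B) (l := atTop)
      (K := 2) (g := v) (μ := volume) hr0
      (Filter.Eventually.of_forall fun n => by simp only [B]; linarith) hint.locallyIntegrable
    rw [ae_restrict_iff' (aux_measH N hN)]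
    filter_upwards [h1] with y hy hyH
    have hy0 : 0 < y ⟨0, hN⟩ := hyH
    apply ENNReal.tendsto_ofReal
    have h2 : Tendsto (fun n => y ⟨0, hN⟩ + 2 * r n) atTop (nhds (y ⟨0, hN⟩)) := by
      simpa using (hr0.const_mul 2).const_add (y ⟨0, hN⟩)
    exact Tendsto.div ((hy.abs).rpow_const (Or.inr hp0.le)) (h2.rpow_const (Or.inr hsp0.le))
      (by positivity)
  · intro n
    refine le_trans ?_ ((aux_hardy_mul_le N s p hp0 _ (V n) (hVs n) (hVc n) (hVt n) ?_).trans (hgag n))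
    · refine mul_le_mul' le_rfl ?_
      rw [← lintegral_indicator (aux_measH N hN), ← lintegral_indicator (aux_measH N hN)]
      rw [← lintegral_add_right_eq_self ((halfSpace N hN).indicator fun x => ENNReal.ofReal
        (|V n x| ^ p / Metric.infDist x (frontier (halfSpace N hN)) ^ (s * p))) (d n)]
      refine lintegral_mono fun y => ?_
      by_cases hy : y ∈ halfSpace N hN
      · have hy' : y + d n ∈ halfSpace N hN := by
          have h1 : 0 < y ⟨0, hN⟩ := hy
          have := hr n
          change 0 < (y + d n) ⟨0, hN⟩
          rw [PiLp.add_apply, hd0]; positivity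
        rw [indicator_of_mem hy, indicator_of_mem hy', aux_infDist N hN _ hy']
        simp [V, hd0]
      · simp [hy]
    · have h1 : Integrable (fun x => |V n x| ^ p / (r n) ^ (s * p)) := by
        refine Integrable.div_const (Continuous.integrable_of_hasCompactSupport ?_ ?_) _
        · exact Continuous.rpow_const (hVs n).continuous.abs (fun _ => Or.inr hp0.le)
        · refine (hVc n).mono (fun x hx h => hx ?_)
          simp [h, Real.zero_rpow hp0.ne']
      refine ne_of_lt (lt_of_le_of_lt ?_ h1.lintegral_lt_top)
      refine le_trans ?_ (setLIntegral_le_lintegral (halfSpace N hN) _)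
      refine setLIntegral_mono' (aux_measH N hN) fun x hx => ?_
      rw [aux_infDist N hN x hx]
      apply ENNReal.ofReal_le_ofReal
      by_cases h : V n x = 0
      · simp [h, Real.zero_rpow hp0.ne']
      · have := hV0 n x h
        have := hr n
        gcongr

lemma aux_vol_pi {N : ℕ} (S : Fin N → Set ℝ) (hS : ∀ i, MeasurableSet (S i)) :
    volume {x : EuclideanSpace ℝ (Fin N) | ∀ i, x i ∈ S i} = ∏ i, volume (S i) := by
  have h := (PiLp.volume_preserving_ofLp (Fin N)).measure_preimage
    (s := Set.pi Set.univ S) (MeasurableSet.univ_pi hS).nullMeasurableSet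
  rw [volume_pi_pi] at h
  rw [← h]
  congr 1
  ext x; simp

lemma aux_meas_pi {N : ℕ} (S : Fin N → Set ℝ) (hS : ∀ i, MeasurableSet (S i)) :
    MeasurableSet {x : EuclideanSpace ℝ (Fin N) | ∀ i, x i ∈ S i} := by
  have : {x : EuclideanSpace ℝ (Fin N) | ∀ i, x i ∈ S i} = ⋂ i, {x | x i ∈ S i} := by
    ext x; simp
  rw [this]
  refine MeasurableSet.iInter fun i => ?_
  exact (show Measurable (fun x : EuclideanSpace ℝ (Fin N) => x i) by fun_prop) (hS i)

lemma aux_vol_pi_inter {N : ℕ} (S : Fin N → Set ℝ) (hS : ∀ i, MeasurableSet (S i)) (i : Fin N)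
    (T : Set ℝ) (hT : MeasurableSet T) :
    volume {x : EuclideanSpace ℝ (Fin N) | (∀ j, x j ∈ S j) ∧ x i ∈ T} =
      volume (S i ∩ T) * ∏ j ∈ Finset.univ \ {i}, volume (S j) := by
  have h1 : {x : EuclideanSpace ℝ (Fin N) | (∀ j, x j ∈ S j) ∧ x i ∈ T} =
      {x | ∀ j, x j ∈ Function.update S i (S i ∩ T) j} := by
    ext x
    simp only [mem_ofPred_eq]
    constructor
    · rintro ⟨h, h'⟩ j
      by_cases hj : j = i
      · subst hj; simp [h j, h']
      · simp [hj, h j]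
    · intro h
      have hi := h i
      simp only [Function.update_self] at hi
      refine ⟨fun j => ?_, hi.2⟩
      by_cases hj : j = i
      · subst hj; exact hi.1
      · simpa [hj] using h j
  rw [h1, aux_vol_pi]
  · rw [← Finset.prod_update_of_mem (Finset.mem_univ i) (fun j => volume (S j))]
    congr 1; ext j
    by_cases hj : j = i
    · subst hj; simp
    · simp [hj]
  · intro j
    by_cases hj : j = i
    · subst hj; simpa using (hS j).inter hT
    · simpa [hj] using hS j

/-- sides of the box. -/
noncomputable def auxI (N : ℕ) (hN : 0 < N) (t R : ℝ) (i : Fin N) : Set ℝ :=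
  if i = ⟨0, hN⟩ then Ioo 0 t else Ioo (-R) R

/-- the box. -/
noncomputable def auxE (N : ℕ) (hN : 0 < N) (t R : ℝ) : Set (EuclideanSpace ℝ (Fin N)) :=
  {x | ∀ i, x i ∈ auxI N hN t R i}

lemma auxI_meas (N : ℕ) (hN : 0 < N) (t R : ℝ) (i : Fin N) : MeasurableSet (auxI N hN t R i) := by
  unfold auxI; split_ifs <;> exact measurableSet_Ioo

lemma auxE_meas (N : ℕ) (hN : 0 < N) (t R : ℝ) : MeasurableSet (auxE N hN t R) :=
  aux_meas_pi _ (auxI_meas N hN t R)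

lemma auxE_vol (N : ℕ) (hN : 0 < N) (t R : ℝ) (i : Fin N) : volume (auxE N hN t R) =
    volume (auxI N hN t R i) * ∏ j ∈ Finset.univ \ {i}, volume (auxI N hN t R j) := by
  have := aux_vol_pi_inter _ (auxI_meas N hN t R) i Set.univ MeasurableSet.univ
  simpa [auxE] using this

lemma aux_interval (a b c : ℝ) : volume (Ioo a b ∩ {y | y + c ∉ Ioo a b}) ≤
    ENNReal.ofReal |c| := by
  rcases le_total 0 c with h | h
  · refine (measure_mono (t := Icc (b - c) b) ?_).trans ?_
    · rintro y ⟨⟨h1, h2⟩, h3⟩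
      simp only [mem_ofPred_eq, mem_Ioo, not_and, not_lt] at h3
      have := h3 (by linarith)
      exact ⟨by linarith, h2.le⟩
    · rw [Real.volume_Icc, abs_of_nonneg h]; apply ENNReal.ofReal_le_ofReal; linarith
  · refine (measure_mono (t := Icc a (a - c)) ?_).trans ?_
    · rintro y ⟨⟨h1, h2⟩, h3⟩
      refine ⟨h1.le, ?_⟩
      by_contra h4
      exact h3 ⟨by linarith, by linarith⟩
    · rw [Real.volume_Icc, abs_of_nonpos h]; apply ENNReal.ofReal_le_ofReal; linarith

lemma aux_slab (N : ℕ) (hN : 0 < N) (t R c : ℝ) :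
    volume {x | x ∈ auxE N hN t R ∧ x ⟨0, hN⟩ ≤ c} =
    volume (Ioo 0 t ∩ Iic c) * ∏ j ∈ Finset.univ \ {⟨0, hN⟩}, volume (auxI N hN t R j) := by
  have := aux_vol_pi_inter _ (auxI_meas N hN t R) ⟨0, hN⟩ (Iic c) measurableSet_Iic
  simpa [auxI, auxE] using this

lemma aux_psi (N : ℕ) (hN : 0 < N) (t R : ℝ) (ht : 0 < t) (hR : 0 < R)
    (z : EuclideanSpace ℝ (Fin N)) :
    volume {x | x ∈ auxE N hN t R ∧ x + z ∉ auxE N hN t R} ≤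
      volume {x | x ∈ auxE N hN t R ∧ x ⟨0, hN⟩ ≤ |z ⟨0, hN⟩|} +
      N * volume (auxE N hN t R) * ENNReal.ofReal (min 1 (‖z‖ / R)) := by
  have hsub : {x | x ∈ auxE N hN t R ∧ x + z ∉ auxE N hN t R} ⊆
      ⋃ i, {x | x ∈ auxE N hN t R ∧ x i ∈ {y | y + z i ∉ auxI N hN t R i}} := by
    rintro x ⟨hx, hxz⟩
    simp only [auxE, mem_ofPred_eq, not_forall] at hxz
    obtain ⟨i, hi⟩ := hxz
    exact mem_iUnion.2 ⟨i, hx, hi⟩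
  have hmT : ∀ i, MeasurableSet {y : ℝ | y + z i ∉ auxI N hN t R i} := by
    intro i
    exact ((measurable_add_const (z i)) (auxI_meas N hN t R i)).compl
  have hi0 : volume {x | x ∈ auxE N hN t R ∧
      x ⟨0, hN⟩ ∈ {y | y + z ⟨0, hN⟩ ∉ auxI N hN t R ⟨0, hN⟩}} ≤
      volume {x | x ∈ auxE N hN t R ∧ x ⟨0, hN⟩ ≤ |z ⟨0, hN⟩|} := by
    rw [aux_slab]
    refine (aux_vol_pi_inter _ (auxI_meas N hN t R) ⟨0, hN⟩ _ (hmT _)).le.trans ?_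
    refine mul_le_mul' ?_ le_rfl
    simp only [auxI, if_true]
    have h1 := aux_interval 0 t (z ⟨0, hN⟩)
    have h2 : volume (Ioo 0 t ∩ {y | y + z ⟨0, hN⟩ ∉ Ioo 0 t}) ≤ ENNReal.ofReal t := by
      refine (measure_mono inter_subset_left).trans ?_
      simp
    calc _ ≤ ENNReal.ofReal (min t |z ⟨0, hN⟩|) := by
          rcases min_choice t |z ⟨0, hN⟩| with h | h <;> rw [h] <;> assumption
      _ = volume (Ioo 0 (min t |z ⟨0, hN⟩|)) := by simp
      _ ≤ volume (Ioo 0 t ∩ Iic |z ⟨0, hN⟩|) := measure_mono fun y hy =>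
          ⟨⟨hy.1, hy.2.trans_le (min_le_left _ _)⟩, (hy.2.trans_le (min_le_right _ _)).le⟩
  have hi : ∀ i, i ≠ ⟨0, hN⟩ → volume {x | x ∈ auxE N hN t R ∧
      x i ∈ {y | y + z i ∉ auxI N hN t R i}} ≤
      volume (auxE N hN t R) * ENNReal.ofReal (min 1 (‖z‖ / R)) := by
    intro i hi
    have h1 : volume {x | x ∈ auxE N hN t R ∧
      x i ∈ {y | y + z i ∉ auxI N hN t R i}} ≤ volume (auxE N hN t R) :=
      measure_mono fun x hx => hx.1
    have h2 : volume {x | x ∈ auxE N hN t R ∧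
      x i ∈ {y | y + z i ∉ auxI N hN t R i}} ≤
        volume (auxE N hN t R) * ENNReal.ofReal (‖z‖ / R) := by
      refine (aux_vol_pi_inter _ (auxI_meas N hN t R) i _ (hmT _)).le.trans ?_
      rw [auxE_vol N hN t R i, mul_right_comm]
      refine mul_le_mul' ?_ le_rfl
      simp only [auxI, if_neg hi]
      refine (aux_interval (-R) R (z i)).trans ?_
      rw [Real.volume_Ioo, ← ENNReal.ofReal_mul (by linarith)]
      apply ENNReal.ofReal_le_ofReal
      have h3 := PiLp.norm_apply_le z i
      rw [Real.norm_eq_abs] at h3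
      have : (R - -R) * (‖z‖ / R) = 2 * ‖z‖ := by field_simp; ring
      rw [this]
      linarith [norm_nonneg z]
    rcases min_choice 1 (‖z‖ / R) with h | h <;> rw [h]
    · simpa using h1
    · exact h2
  refine (measure_mono hsub).trans ((measure_iUnion_le _).trans ?_)
  rw [tsum_fintype, ← Finset.add_sum_erase _ _ (Finset.mem_univ (⟨0, hN⟩ : Fin N))]
  refine add_le_add hi0 ?_
  refine (Finset.sum_le_card_nsmul _ _
    (volume (auxE N hN t R) * ENNReal.ofReal (min 1 (‖z‖ / R)))
    (fun i h => hi i (Finset.ne_of_mem_erase h))).trans ?_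
  rw [nsmul_eq_mul, mul_assoc]
  refine mul_le_mul' ?_ le_rfl
  have := Finset.card_erase_le (s := Finset.univ) (a := (⟨0, hN⟩ : Fin N))
  rw [Finset.card_univ, Fintype.card_fin] at this
  exact_mod_cast this

lemma auxE_H (N : ℕ) (hN : 0 < N) (t R : ℝ) (x : EuclideanSpace ℝ (Fin N))
    (hx : x ∈ auxE N hN t R) : 0 < x ⟨0, hN⟩ ∧ x ⟨0, hN⟩ < t := by
  have := hx ⟨0, hN⟩
  simpa [auxI] using this

/-- real indicator of the box. -/
noncomputable def auxf (N : ℕ) (hN : 0 < N) (t R : ℝ) : EuclideanSpace ℝ (Fin N) → ℝ :=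
  (auxE N hN t R).indicator 1

lemma auxf_meas (N : ℕ) (hN : 0 < N) (t R : ℝ) : Measurable (auxf N hN t R) :=
  measurable_one.indicator (auxE_meas N hN t R)

lemma aux_P (N : ℕ) (hN : 0 < N) (σ t R : ℝ) (ht : 0 < t) (hR : 0 < R) :
    ∫⁻ z, auxK N σ z * ∫⁻ x, ENNReal.ofReal |auxf N hN t R x - auxf N hN t R (x + z)| ≤
    2 * (∫⁻ z in {z : EuclideanSpace ℝ (Fin N) | 1 ≤ |z ⟨0, hN⟩|}, auxK N σ z) *
       (∫⁻ x in halfSpace N hN, ENNReal.ofReal (auxf N hN t R x) *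
          ENNReal.ofReal (1 / (x ⟨0, hN⟩) ^ σ)) +
    2 * N * volume (auxE N hN t R) *
      ∫⁻ z, auxK N σ z * ENNReal.ofReal (min 1 (‖z‖ / R)) := by
  have hK := auxK_meas N σ
  have hf := auxf_meas N hN t R
  have hE := auxE_meas N hN t R
  rw [mul_assoc 2, ← aux_swap N hN σ (fun x => ENNReal.ofReal (auxf N hN t R x)) (by fun_prop)]
  swap
  · intro x hx
    have : x ∉ auxE N hN t R := fun h => hx (auxE_H N hN t R x h).1
    simp [auxf, this]
  have hslab : ∀ c : ℝ, ∫⁻ x in {x | x ⟨0, hN⟩ ≤ c}, ENNReal.ofReal (auxf N hN t R x) =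
      volume {x | x ∈ auxE N hN t R ∧ x ⟨0, hN⟩ ≤ c} := by
    intro c
    have h1 : ∀ x, ENNReal.ofReal (auxf N hN t R x) = (auxE N hN t R).indicator 1 x := by
      intro x
      by_cases hx : x ∈ auxE N hN t R <;> simp [auxf, hx]
    simp_rw [h1]
    rw [lintegral_indicator_one hE, Measure.restrict_apply hE]
    rfl
  simp_rw [hslab]
  have hphi : ∀ z, ∫⁻ x, ENNReal.ofReal |auxf N hN t R x - auxf N hN t R (x + z)| ≤
      2 * (volume {x | x ∈ auxE N hN t R ∧ x ⟨0, hN⟩ ≤ |z ⟨0, hN⟩|} +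
      N * volume (auxE N hN t R) * ENNReal.ofReal (min 1 (‖z‖ / R))) := by
    intro z
    have hm1 : MeasurableSet {x | x ∈ auxE N hN t R ∧ x + z ∉ auxE N hN t R} :=
      hE.inter ((measurable_add_const z) hE).compl
    have hm2 : MeasurableSet {x | x ∈ auxE N hN t R ∧ x + -z ∉ auxE N hN t R} :=
      hE.inter ((measurable_add_const (-z)) hE).compl
    have hm3 : MeasurableSet {x | x ∉ auxE N hN t R ∧ x + z ∈ auxE N hN t R} :=
      hE.compl.inter ((measurable_add_const z) hE)
    calc _ ≤ ∫⁻ x, ({x | x ∈ auxE N hN t R ∧ x + z ∉ auxE N hN t R}.indicator 1 x +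
            {x | x ∉ auxE N hN t R ∧ x + z ∈ auxE N hN t R}.indicator 1 x : ℝ≥0∞) := by
          refine lintegral_mono fun x => ?_
          by_cases h1 : x ∈ auxE N hN t R <;> by_cases h2 : x + z ∈ auxE N hN t R <;>
            simp [auxf, h1, h2]
      _ = volume {x | x ∈ auxE N hN t R ∧ x + z ∉ auxE N hN t R} +
          volume {x | x ∉ auxE N hN t R ∧ x + z ∈ auxE N hN t R} := by
          rw [lintegral_add_left (measurable_one.indicator hm1), lintegral_indicator_one hm1,
            lintegral_indicator_one hm3]
      _ = volume {x | x ∈ auxE N hN t R ∧ x + z ∉ auxE N hN t R} +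
          volume {x | x ∈ auxE N hN t R ∧ x + -z ∉ auxE N hN t R} := by
          congr 1
          rw [← measure_preimage_add_right volume z {x | x ∈ auxE N hN t R ∧ x + -z ∉ auxE N hN t R}]
          congr 1
          ext x
          simp [and_comm]
      _ ≤ _ := by
          rw [two_mul]
          refine add_le_add (aux_psi N hN t R ht hR z) ((aux_psi N hN t R ht hR (-z)).trans ?_)
          simp
  refine (lintegral_mono fun z => mul_le_mul' le_rfl (hphi z)).trans (le_of_eq ?_)
  have hms : Measurable fun z : EuclideanSpace ℝ (Fin N) =>
      volume {x | x ∈ auxE N hN t R ∧ x ⟨0, hN⟩ ≤ |z ⟨0, hN⟩|} := by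
    have : Monotone fun c : ℝ => volume {x | x ∈ auxE N hN t R ∧ x ⟨0, hN⟩ ≤ c} := fun a b hab =>
      measure_mono fun x hx => ⟨hx.1, hx.2.trans hab⟩
    exact this.measurable.comp (by fun_prop)
  rw [← lintegral_const_mul _ (by fun_prop), ← lintegral_const_mul _ (by fun_prop),
    ← lintegral_add_left (by fun_prop)]
  congr 1; ext z
  ring

lemma auxE_fin (N : ℕ) (hN : 0 < N) (t R : ℝ) : volume (auxE N hN t R) ≠ ∞ := by
  unfold auxE
  rw [aux_vol_pi _ (auxI_meas N hN t R)]
  refine ENNReal.prod_ne_top fun i _ => ?_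
  unfold auxI
  split_ifs <;> simp

lemma auxE_pos (N : ℕ) (hN : 0 < N) (t R : ℝ) (ht : 0 < t) (hR : 0 < R) :
    volume (auxE N hN t R) ≠ 0 := by
  unfold auxE
  rw [aux_vol_pi _ (auxI_meas N hN t R), Finset.prod_ne_zero_iff]
  intro i _
  unfold auxI
  split_ifs
  · simp [ht]
  · simp [hR]

lemma aux_Yfin (N : ℕ) (hN : 0 < N) (σ t R : ℝ) (h0 : 0 < σ) (h1 : σ < 1) (ht : 1 ≤ t) :
    (∫⁻ z in {z : EuclideanSpace ℝ (Fin N) | 1 ≤ |z ⟨0, hN⟩|}, auxK N σ z) *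
       (∫⁻ x in halfSpace N hN, ENNReal.ofReal (auxf N hN t R x) *
          ENNReal.ofReal (1 / (x ⟨0, hN⟩) ^ σ)) ≠ ∞ := by
  have hK := auxK_meas N σ
  have hf := auxf_meas N hN t R
  have hE := auxE_meas N hN t R
  rw [← aux_swap N hN σ (fun x => ENNReal.ofReal (auxf N hN t R x)) (by fun_prop)]
  swap
  · intro x hx
    have : x ∉ auxE N hN t R := fun h => hx (auxE_H N hN t R x h).1
    simp [auxf, this]
  have hslab : ∀ c : ℝ, ∫⁻ x in {x | x ⟨0, hN⟩ ≤ c}, ENNReal.ofReal (auxf N hN t R x) =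
      volume {x | x ∈ auxE N hN t R ∧ x ⟨0, hN⟩ ≤ c} := by
    intro c
    have h1 : ∀ x, ENNReal.ofReal (auxf N hN t R x) = (auxE N hN t R).indicator 1 x := by
      intro x
      by_cases hx : x ∈ auxE N hN t R <;> simp [auxf, hx]
    simp_rw [h1]
    rw [lintegral_indicator_one hE, Measure.restrict_apply hE]
    rfl
  simp_rw [hslab]
  have hb : ∀ z : EuclideanSpace ℝ (Fin N),
      volume {x | x ∈ auxE N hN t R ∧ x ⟨0, hN⟩ ≤ |z ⟨0, hN⟩|} ≤
      volume (auxE N hN t R) * ENNReal.ofReal (min 1 ‖z‖) := by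
    intro z
    rw [aux_slab, auxE_vol N hN t R ⟨0, hN⟩, mul_right_comm]
    refine mul_le_mul' ?_ le_rfl
    simp only [auxI, if_true]
    rw [Real.volume_Ioo, sub_zero, ← ENNReal.ofReal_mul (by linarith)]
    have h3 := PiLp.norm_apply_le z ⟨0, hN⟩
    rw [Real.norm_eq_abs] at h3
    rcases le_total 1 ‖z‖ with h | h
    · rw [min_eq_left h, mul_one]
      refine (measure_mono inter_subset_left).trans ?_
      simp
    · rw [min_eq_right h]
      refine (measure_mono (t := Ioc 0 |z ⟨0, hN⟩|) (fun y hy => ⟨hy.1.1, hy.2⟩)).trans ?_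
      rw [Real.volume_Ioc, sub_zero]
      apply ENNReal.ofReal_le_ofReal
      nlinarith [norm_nonneg z]
  refine ne_of_lt (lt_of_le_of_lt (lintegral_mono fun z => mul_le_mul' le_rfl (hb z)) ?_)
  have : ∀ z : EuclideanSpace ℝ (Fin N),
      auxK N σ z * (volume (auxE N hN t R) * ENNReal.ofReal (min 1 ‖z‖)) =
      volume (auxE N hN t R) * (auxK N σ z * ENNReal.ofReal (min 1 ‖z‖)) := fun z => by ring
  simp_rw [this]
  rw [lintegral_const_mul _ (by fun_prop)]
  exact ENNReal.mul_lt_top (lt_top_iff_ne_top.2 (auxE_fin N hN t R))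
    (lt_top_iff_ne_top.2 (auxK_int N hN σ h0 h1))

lemma aux_eps (N : ℕ) (hN : 0 < N) (σ : ℝ) (h0 : 0 < σ) (h1 : σ < 1) :
    Tendsto (fun n : ℕ => ∫⁻ z, auxK N σ z * ENNReal.ofReal (min 1 (‖z‖ / ((n : ℝ) + 1))))
      atTop (nhds 0) := by
  have hK := auxK_meas N σ
  have := tendsto_lintegral_filter_of_dominated_convergence (μ := volume) (l := atTop)
    (F := fun (n : ℕ) (z : EuclideanSpace ℝ (Fin N)) =>
      auxK N σ z * ENNReal.ofReal (min 1 (‖z‖ / ((n : ℝ) + 1)))) (f := fun _ => 0)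
    (fun z => auxK N σ z * ENNReal.ofReal (min 1 ‖z‖)) ?_ ?_ (auxK_int N hN σ h0 h1) ?_
  · simpa using this
  · exact Filter.Eventually.of_forall fun n => by fun_prop
  · refine Filter.Eventually.of_forall fun n => Filter.Eventually.of_forall fun z => ?_
    refine mul_le_mul' le_rfl (ENNReal.ofReal_le_ofReal (min_le_min le_rfl ?_))
    apply div_le_self (norm_nonneg _)
    have : (0:ℝ) ≤ n := n.cast_nonneg
    linarith
  · refine Filter.Eventually.of_forall fun z => ?_
    have h2 : Tendsto (fun n : ℕ => min 1 (‖z‖ / ((n : ℝ) + 1))) atTop (nhds 0) := by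
      have h3 : Tendsto (fun n : ℕ => ‖z‖ / ((n : ℝ) + 1)) atTop (nhds 0) := by
        have := (tendsto_one_div_add_atTop_nhds_zero_nat (𝕜 := ℝ)).const_mul ‖z‖
        simpa [mul_one_div, div_eq_mul_inv] using this
      have := (tendsto_const_nhds (x := (1:ℝ))).min h3
      simpa using this
    have h4 := ENNReal.tendsto_ofReal h2
    rw [ENNReal.ofReal_zero] at h4
    have := ENNReal.Tendsto.const_mul (a := auxK N σ z) h4 (Or.inr (by simp [auxK]))
    simpa using this

lemma aux_J (N : ℕ) (hN : 0 < N) (σ R : ℝ) (h0 : 0 < σ) (hR : 1 ≤ R)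
    (x : EuclideanSpace ℝ (Fin N)) (hx : x ∈ auxE N hN 1 R) :
    ENNReal.ofReal (1 / (2 * (N:ℝ)) ^ ((N:ℝ) + σ)) ≤
      ∫⁻ z, auxK N σ z * ({z | x + z ∈ auxE N hN 2 R ∧ x + z ∉ auxE N hN 1 R}.indicator 1 z) := by
  let S : Fin N → Set ℝ := fun i =>
    if i = ⟨0, hN⟩ then Ioo (1 - x i) (2 - x i) else if 0 < x i then Ioo (-1) 0 else Ioo 0 1
  have hS : ∀ i, MeasurableSet (S i) := by
    intro i; simp only [S]; split_ifs <;> exact measurableSet_Ioo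
  have hvol : volume {z : EuclideanSpace ℝ (Fin N) | ∀ i, z i ∈ S i} = 1 := by
    rw [aux_vol_pi S hS]
    apply Finset.prod_eq_one
    intro i _
    simp only [S]
    split_ifs <;> rw [Real.volume_Ioo] <;> norm_num
  have hms := aux_meas_pi S hS
  have hx0 := auxE_H N hN 1 R x hx
  calc ENNReal.ofReal (1 / (2 * (N:ℝ)) ^ ((N:ℝ) + σ))
      = ∫⁻ z in {z : EuclideanSpace ℝ (Fin N) | ∀ i, z i ∈ S i},
          ENNReal.ofReal (1 / (2 * (N:ℝ)) ^ ((N:ℝ) + σ)) := by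
        rw [setLIntegral_const, hvol, mul_one]
    _ ≤ ∫⁻ z in {z : EuclideanSpace ℝ (Fin N) | ∀ i, z i ∈ S i}, auxK N σ z *
          ({z | x + z ∈ auxE N hN 2 R ∧ x + z ∉ auxE N hN 1 R}.indicator 1 z) := by
        refine setLIntegral_mono' hms fun z hz => ?_
        have hz0 : z ⟨0, hN⟩ ∈ Ioo (1 - x ⟨0, hN⟩) (2 - x ⟨0, hN⟩) := by
          have := hz ⟨0, hN⟩
          simpa [S] using this
        have hmem : z ∈ {z | x + z ∈ auxE N hN 2 R ∧ x + z ∉ auxE N hN 1 R} := by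
          constructor
          · intro i
            have hzi := hz i
            have hxi := hx i
            simp only [auxI, S, PiLp.add_apply] at hzi hxi ⊢
            split_ifs at hzi hxi ⊢ with h1 h2
            · exact ⟨by linarith [hzi.1], by linarith [hzi.2]⟩
            · exact ⟨by linarith [hzi.1], by linarith [hzi.2, hxi.2]⟩
            · exact ⟨by linarith [hzi.1, hxi.1], by linarith [hzi.2]⟩
          · intro h
            have := (auxE_H N hN 1 R _ h).2
            rw [PiLp.add_apply] at this
            linarith [hz0.1]
        rw [indicator_of_mem hmem, Pi.one_apply, mul_one]
        unfold auxK
        apply ENNReal.ofReal_le_ofReal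
        have hzpos : 0 < ‖z‖ := by
          have h3 := PiLp.norm_apply_le z ⟨0, hN⟩
          rw [Real.norm_eq_abs] at h3
          have := le_abs_self (z ⟨0, hN⟩)
          linarith [hz0.1]
        have hN1 : (1:ℝ) ≤ N := by exact_mod_cast hN
        have hzle : ‖z‖ ≤ 2 * N := by
          rw [EuclideanSpace.norm_eq]
          apply Real.sqrt_le_iff.2 ⟨by positivity, ?_⟩
          calc ∑ i, ‖z i‖ ^ 2 ≤ ∑ i : Fin N, (4:ℝ) := by
                refine Finset.sum_le_sum fun i _ => ?_
                have hzi := hz i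
                have : |z i| ≤ 2 := by
                  simp only [S] at hzi
                  rw [abs_le]
                  split_ifs at hzi with h1 h2
                  · subst h1
                    exact ⟨by linarith [hzi.1], by linarith [hzi.2]⟩
                  · exact ⟨by linarith [hzi.1], by linarith [hzi.2]⟩
                  · exact ⟨by linarith [hzi.1], by linarith [hzi.2]⟩
                rw [Real.norm_eq_abs]
                nlinarith [abs_nonneg (z i)]
            _ = 4 * N := by simp [mul_comm]
            _ ≤ (2 * N) ^ 2 := by nlinarith
        exact one_div_le_one_div_of_le (by positivity)
          (Real.rpow_le_rpow hzpos.le hzle (by positivity))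
    _ ≤ _ := setLIntegral_le_lintegral _ _

lemma aux_kappa (p : ℝ) (hp : 1 < p) : 0 < 1 - ((2:ℝ) ^ (1/p) - 1) ^ p := by
  have h1 : (2:ℝ) ^ (1/p) < 2 := by
    calc (2:ℝ) ^ (1/p) < 2 ^ (1:ℝ) := by
          apply Real.rpow_lt_rpow_of_exponent_lt (by norm_num)
          rw [div_lt_one (by linarith)]; exact hp
      _ = 2 := Real.rpow_one 2
  have h2 : (1:ℝ) ≤ 2 ^ (1/p) := Real.one_le_rpow (by norm_num) (by positivity)
  have := Real.rpow_lt_one (x := (2:ℝ) ^ (1/p) - 1) (z := p) (by linarith) (by linarith)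
    (by linarith)
  linarith

lemma aux_point (N : ℕ) (hN : 0 < N) (p R : ℝ) (hp : 1 < p) (x y : EuclideanSpace ℝ (Fin N)) :
    ENNReal.ofReal (|(auxf N hN 1 R x + auxf N hN 2 R x) ^ (1/p) -
      (auxf N hN 1 R y + auxf N hN 2 R y) ^ (1/p)| ^ p) +
      ENNReal.ofReal (1 - ((2:ℝ) ^ (1/p) - 1) ^ p) * ((auxE N hN 1 R).indicator 1 x *
       ({y | y ∈ auxE N hN 2 R ∧ y ∉ auxE N hN 1 R}.indicator 1 y)) ≤
    ENNReal.ofReal |auxf N hN 1 R x - auxf N hN 1 R y| +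
    ENNReal.ofReal |auxf N hN 2 R x - auxf N hN 2 R y| := by
  have hp0 : 0 < p := by linarith
  have hsub : ∀ x, x ∈ auxE N hN 1 R → x ∈ auxE N hN 2 R := by
    intro x hx i
    have := hx i
    simp only [auxI] at this ⊢
    split_ifs at this ⊢
    · exact ⟨this.1, by linarith [this.2]⟩
    · exact this
  have hn : ∀ t x, 0 ≤ auxf N hN t R x := fun t x => indicator_nonneg (fun _ _ => by simp) x
  have hκ := aux_kappa p hp
  by_cases h : x ∈ auxE N hN 1 R ∧ y ∈ auxE N hN 2 R ∧ y ∉ auxE N hN 1 R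
  · obtain ⟨h1, h2, h3⟩ := h
    have h4 := hsub x h1
    have h5 : (1:ℝ) ≤ 2 ^ (1/p) := Real.one_le_rpow (by norm_num) (by positivity)
    have hm : y ∈ {y | y ∈ auxE N hN 2 R ∧ y ∉ auxE N hN 1 R} := ⟨h2, h3⟩
    rw [indicator_of_mem h1, indicator_of_mem hm]
    simp only [auxf, h1, h2, h3, h4, indicator_of_mem, indicator_of_notMem, not_false_eq_true,
      Pi.one_apply, mul_one, zero_add, Real.one_rpow, sub_zero, sub_self, abs_zero, abs_one,
      ENNReal.ofReal_zero, add_zero]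
    rw [show (1:ℝ) + 1 = 2 by norm_num, abs_of_nonneg (by linarith),
      ← ENNReal.ofReal_add (Real.rpow_nonneg (by linarith) _) hκ.le]
    simp
  · have : ((auxE N hN 1 R).indicator 1 x *
       ({y | y ∈ auxE N hN 2 R ∧ y ∉ auxE N hN 1 R}.indicator 1 y) : ℝ≥0∞) = 0 := by
      by_cases h1 : x ∈ auxE N hN 1 R
      · have : y ∉ {y | y ∈ auxE N hN 2 R ∧ y ∉ auxE N hN 1 R} := fun h' => h ⟨h1, h'⟩
        rw [indicator_of_notMem this, mul_zero]
      · rw [indicator_of_notMem h1, zero_mul]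
    rw [this, mul_zero, add_zero, ← ENNReal.ofReal_add (abs_nonneg _) (abs_nonneg _)]
    apply ENNReal.ofReal_le_ofReal
    refine (aux_rpow_diff hp (add_nonneg (hn _ _) (hn _ _)) (add_nonneg (hn _ _) (hn _ _))).trans ?_
    rw [add_sub_add_comm]
    exact abs_add_le _ _

lemma aux_upper (N : ℕ) (hN : 0 < N) (s p : ℝ) (hp : 1 < p) (hs : 0 < s) (hsp : s * p < 1) :
    hardyConst N s p (halfSpace N hN) <
    2 * (∫⁻ z in {z : EuclideanSpace ℝ (Fin N) | 1 ≤ |z ⟨0, hN⟩|}, auxK N (s * p) z) := by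
  have hp0 : 0 < p := by linarith
  set σ := s * p with hσ
  have hσ0 : 0 < σ := by positivity
  have hK := auxK_meas N σ
  set C := ∫⁻ z in {z : EuclideanSpace ℝ (Fin N) | 1 ≤ |z ⟨0, hN⟩|}, auxK N σ z with hC
  set κ := ENNReal.ofReal (1 - ((2:ℝ) ^ (1/p) - 1) ^ p) with hκ
  have hκ0 : 0 < κ := ENNReal.ofReal_pos.2 (aux_kappa p hp)
  set K0 := ENNReal.ofReal (1 / (2 * (N:ℝ)) ^ ((N:ℝ) + σ)) with hK0
  have hNr : (0:ℝ) < N := by exact_mod_cast hN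
  have hK00 : 0 < K0 := ENNReal.ofReal_pos.2 (by positivity)
  obtain ⟨n, hn⟩ : ∃ n : ℕ, 6 * N * (∫⁻ z : EuclideanSpace ℝ (Fin N), auxK N σ z *
      ENNReal.ofReal (min 1 (‖z‖ / ((n : ℝ) + 1)))) < κ * K0 := by
    have h1 := ENNReal.Tendsto.const_mul (a := 6 * N) (aux_eps N hN σ hσ0 hsp)
      (Or.inr (by exact ENNReal.mul_ne_top (by simp) (by simp)))
    rw [mul_zero] at h1
    exact (h1.eventually_lt_const (ENNReal.mul_pos hκ0.ne' hK00.ne')).exists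
  set R : ℝ := (n:ℝ) + 1 with hRdef
  have hR : 1 ≤ R := by have : (0:ℝ) ≤ n := n.cast_nonneg; linarith
  have hR0 : 0 < R := by linarith
  set ε := ∫⁻ z : EuclideanSpace ℝ (Fin N), auxK N σ z * ENNReal.ofReal (min 1 (‖z‖ / R)) with hε
  set f : EuclideanSpace ℝ (Fin N) → ℝ := fun x => auxf N hN 1 R x + auxf N hN 2 R x with hf
  set v : EuclideanSpace ℝ (Fin N) → ℝ := fun x => (f x) ^ (1/p) with hv
  have hf1 := auxf_meas N hN 1 R
  have hf2 := auxf_meas N hN 2 R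
  have hE1 := auxE_meas N hN 1 R
  have hE2 := auxE_meas N hN 2 R
  have hfm : Measurable f := by fun_prop
  have hvm : Measurable v := by fun_prop
  have hnn : ∀ t x, 0 ≤ auxf N hN t R x := fun t x => indicator_nonneg (fun _ _ => by simp) x
  have hle1 : ∀ t x, auxf N hN t R x ≤ 1 := fun t x => by
    unfold auxf; exact indicator_le_self' (fun _ _ => by simp) x
  have hfn : ∀ x, 0 ≤ f x := fun x => add_nonneg (hnn _ _) (hnn _ _)
  have hvp : ∀ x, |v x| ^ p = f x := by
    intro x
    rw [hv, abs_of_nonneg (Real.rpow_nonneg (hfn x) _), ← Real.rpow_mul (hfn x),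
      one_div_mul_cancel hp0.ne', Real.rpow_one]
  have hsub : ∀ x, x ∈ auxE N hN 1 R → x ∈ auxE N hN 2 R := by
    intro x hx i
    have := hx i
    simp only [auxI] at this ⊢
    split_ifs at this ⊢
    · exact ⟨this.1, by linarith [this.2]⟩
    · exact this
  have hv0 : ∀ x, x ∉ auxE N hN 2 R → v x = 0 := by
    intro x hx
    have h1 : x ∉ auxE N hN 1 R := fun h => hx (hsub x h)
    simp [hv, hf, auxf, hx, h1, hp0.ne']
  have hβ2 : volume (auxE N hN 2 R) = 2 * volume (auxE N hN 1 R) := by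
    rw [auxE_vol N hN 2 R ⟨0, hN⟩, auxE_vol N hN 1 R ⟨0, hN⟩, ← mul_assoc]
    congr 1
    · simp [auxI]
    · refine Finset.prod_congr rfl fun j hj => ?_
      have : j ≠ ⟨0, hN⟩ := by simpa using hj
      simp [auxI, this]
  set β := volume (auxE N hN 1 R) with hβ
  have hβfin : β ≠ ∞ := auxE_fin N hN 1 R
  have hβ0 : β ≠ 0 := auxE_pos N hN 1 R one_pos hR0
  -- integrability and support
  have hbdd : auxE N hN 2 R ⊆ Metric.closedBall 0 ((2 + R) * N) := by
    intro x hx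
    rw [mem_closedBall_zero_iff, EuclideanSpace.norm_eq]
    have hN1 : (1:ℝ) ≤ N := by exact_mod_cast hN
    apply Real.sqrt_le_iff.2 ⟨by positivity, ?_⟩
    calc ∑ i, ‖x i‖ ^ 2 ≤ ∑ i : Fin N, (2 + R) ^ 2 := by
          refine Finset.sum_le_sum fun i _ => ?_
          have hxi := hx i
          have : |x i| ≤ 2 + R := by
            simp only [auxI] at hxi
            rw [abs_le]
            split_ifs at hxi
            · exact ⟨by linarith [hxi.1], by linarith [hxi.2]⟩
            · exact ⟨by linarith [hxi.1], by linarith [hxi.2]⟩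
          rw [Real.norm_eq_abs]
          gcongr
      _ = (2 + R) ^ 2 * N := by simp [mul_comm]
      _ ≤ ((2 + R) * N) ^ 2 := by
          rw [mul_pow]; gcongr; nlinarith
  have hvc : HasCompactSupport v := by
    refine HasCompactSupport.intro (isCompact_closedBall 0 ((2 + R) * N)) fun x hx => ?_
    exact hv0 x fun h => hx (hbdd h)
  have hvint : Integrable v := by
    have h1 : Integrable ((auxE N hN 2 R).indicator (fun _ => (2:ℝ) ^ (1/p))) :=
      (integrable_indicator_iff hE2).2
        (integrableOn_const (auxE_fin N hN 2 R))
    refine h1.mono' hvm.aestronglyMeasurable (Filter.Eventually.of_forall fun x => ?_)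
    by_cases hx : x ∈ auxE N hN 2 R
    · rw [indicator_of_mem hx, Real.norm_eq_abs, abs_of_nonneg (Real.rpow_nonneg (hfn x) _)]
      refine Real.rpow_le_rpow (hfn x) ?_ (by positivity)
      linarith [hle1 1 x, hle1 2 x]
    · rw [indicator_of_notMem hx, hv0 x hx, norm_zero]
  have hmoll := aux_moll N hN s p hp hs v hvm hvint hvc (fun x hx => hv0 x fun h =>
    hx (auxE_H N hN 2 R x h).1)
  set J := ∫⁻ x in halfSpace N hN, ENNReal.ofReal (|v x| ^ p / x ⟨0, hN⟩ ^ (s * p)) with hJ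
  let Jt : ℝ → ℝ≥0∞ := fun t => ∫⁻ x in halfSpace N hN, ENNReal.ofReal (auxf N hN t R x) *
          ENNReal.ofReal (1 / (x ⟨0, hN⟩) ^ σ)
  have hJsum : J = Jt 1 + Jt 2 := by
    simp only [Jt]
    rw [← lintegral_add_left (by fun_prop)]
    refine setLIntegral_congr_fun (aux_measH N hN) fun x hx => ?_
    simp only
    rw [hvp, ← add_mul, ← ENNReal.ofReal_add (hnn _ _) (hnn _ _),
      ← ENNReal.ofReal_mul (hfn x), mul_one_div]
  -- main energy estimate
  set X := gagliardo N s p Set.univ v with hX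
  have hmain : X + κ * K0 * β ≤ 2 * C * J + 6 * N * ε * β := by
    have hP1 := aux_P N hN σ 1 R one_pos hR0
    have hP2 := aux_P N hN σ 2 R two_pos hR0
    have hind1 : Measurable ((auxE N hN 1 R).indicator (1 : EuclideanSpace ℝ (Fin N) → ℝ≥0∞)) :=
      measurable_one.indicator hE1
    have hind2 : Measurable ({y | y ∈ auxE N hN 2 R ∧ y ∉ auxE N hN 1 R}.indicator
        (1 : EuclideanSpace ℝ (Fin N) → ℝ≥0∞)) :=
      measurable_one.indicator (hE2.inter hE1.compl)
    have hJ2 : κ * K0 * β ≤ ∫⁻ z, auxK N σ z * ∫⁻ x, κ * ((auxE N hN 1 R).indicator 1 x *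
       ({y | y ∈ auxE N hN 2 R ∧ y ∉ auxE N hN 1 R}.indicator 1 (x + z))) := by
      have e1 : ∀ z, auxK N σ z * ∫⁻ x, κ * ((auxE N hN 1 R).indicator 1 x *
         ({y | y ∈ auxE N hN 2 R ∧ y ∉ auxE N hN 1 R}.indicator 1 (x + z))) =
         ∫⁻ x, κ * ((auxE N hN 1 R).indicator 1 x * (auxK N σ z *
         ({y | y ∈ auxE N hN 2 R ∧ y ∉ auxE N hN 1 R}.indicator 1 (x + z)))) := by
        intro z
        rw [← lintegral_const_mul _ (by fun_prop)]
        congr 1; ext x; ring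
      simp_rw [e1]
      rw [lintegral_lintegral_swap (by apply Measurable.aemeasurable; fun_prop)]
      calc κ * K0 * β = ∫⁻ x in auxE N hN 1 R, κ * K0 := by rw [setLIntegral_const]
        _ = ∫⁻ x, κ * ((auxE N hN 1 R).indicator 1 x * K0) := by
            rw [← lintegral_indicator hE1]
            congr 1; ext x
            by_cases hx : x ∈ auxE N hN 1 R <;> simp [hx]
        _ ≤ _ := by
            refine lintegral_mono fun x => ?_
            rw [lintegral_const_mul _ (by fun_prop), lintegral_const_mul _ (by fun_prop)]
            refine mul_le_mul' le_rfl ?_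
            by_cases hx : x ∈ auxE N hN 1 R
            · refine mul_le_mul' le_rfl ?_
              exact aux_J N hN σ R hσ0 hR x hx
            · simp [hx]
    calc X + κ * K0 * β ≤ (∫⁻ z, auxK N σ z * ∫⁻ x, ENNReal.ofReal (|v x - v (x + z)| ^ p)) +
          ∫⁻ z, auxK N σ z * ∫⁻ x, κ * ((auxE N hN 1 R).indicator 1 x *
          ({y | y ∈ auxE N hN 2 R ∧ y ∉ auxE N hN 1 R}.indicator 1 (x + z))) := by
          rw [hX, aux_gag_eq N s p v hvm]
          exact add_le_add le_rfl hJ2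
      _ = ∫⁻ z, auxK N σ z * ∫⁻ x, (ENNReal.ofReal (|v x - v (x + z)| ^ p) +
          κ * ((auxE N hN 1 R).indicator 1 x *
          ({y | y ∈ auxE N hN 2 R ∧ y ∉ auxE N hN 1 R}.indicator 1 (x + z)))) := by
          rw [← lintegral_add_left (by fun_prop)]
          congr 1; ext z
          rw [← mul_add, ← lintegral_add_left (by fun_prop)]
      _ ≤ ∫⁻ z, auxK N σ z * ∫⁻ x, (ENNReal.ofReal |auxf N hN 1 R x - auxf N hN 1 R (x + z)| +
          ENNReal.ofReal |auxf N hN 2 R x - auxf N hN 2 R (x + z)|) :=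
          lintegral_mono fun z => mul_le_mul' le_rfl (lintegral_mono fun x =>
            aux_point N hN p R hp x (x + z))
      _ = (∫⁻ z, auxK N σ z * ∫⁻ x, ENNReal.ofReal |auxf N hN 1 R x - auxf N hN 1 R (x + z)|) +
          ∫⁻ z, auxK N σ z * ∫⁻ x, ENNReal.ofReal |auxf N hN 2 R x - auxf N hN 2 R (x + z)| := by
          rw [← lintegral_add_left (by fun_prop)]
          congr 1; ext z
          rw [← mul_add, ← lintegral_add_left (by fun_prop)]
      _ ≤ _ := add_le_add hP1 hP2
      _ = _ := by
          rw [hβ2, hJsum]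
          simp only [Jt]
          ring
  have hYfin : 2 * C * J ≠ ∞ := by
    rw [hJsum, mul_assoc, mul_add]
    exact ENNReal.mul_ne_top (by simp) (ENNReal.add_ne_top.2
      ⟨aux_Yfin N hN σ 1 R hσ0 hsp le_rfl, aux_Yfin N hN σ 2 R hσ0 hsp (by norm_num)⟩)
  have hlt : X < 2 * C * J := by
    by_contra hcon
    push Not at hcon
    have h1 : 2 * C * J + κ * K0 * β ≤ 2 * C * J + 6 * N * ε * β :=
      (add_le_add hcon le_rfl).trans hmain
    have h2 := (ENNReal.add_le_add_iff_left hYfin).1 h1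
    have h3 : 6 * N * ε * β < κ * K0 * β := ENNReal.mul_lt_mul_left hβ0 hβfin hn
    exact absurd h2 (not_le.2 h3)
  by_contra hcon
  push Not at hcon
  exact absurd ((mul_le_mul' hcon (le_refl J)).trans hmoll) (not_le.2 hlt)

theorem hardy_p_le_hardy_one (N : ℕ) (hN : 0 < N) (s p : ℝ) (hp : 1 < p)
    (hs : s ∈ Set.Ioo (0 : ℝ) 1) (hsp : s * p < 1) :
    (∀ Ω : Set (EuclideanSpace ℝ (Fin N)), Ω.Nonempty → IsOpen Ω → Ω ≠ Set.univ →
        hardyConst N s p Ω ≤ hardyConst N (s * p) 1 Ω) ∧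
      hardyConst N s p (halfSpace N hN) < hardyConst N (s * p) 1 (halfSpace N hN) :=
  ⟨fun Ω _ _ _ => aux_part1 N s p hp Ω,
    (aux_upper N hN s p hp hs.1 hsp).trans_le (aux_lower N hN (s * p))⟩
end

section
/- Let N ≥ 1, s ∈ (0,1), and let Ω ⊊ ℝ^N be a nonempty convex open set. Then limsup_{p→1⁺} 𝔥_{s,p}(Ω) ≤ 𝔥_{s,1}(Ω). -/
open MeasureTheory Metric Set Filter
open scoped ENNReal NNReal

theorem aux_holder (N : ℕ) (s : ℝ) (hs : s ∈ Set.Ioo (0 : ℝ) 1)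
    (u : EuclideanSpace ℝ (Fin N) → ℝ) (hu : ContDiff ℝ (⊤ : ℕ∞) u) (hc : HasCompactSupport u) :
    ∃ W : ℝ, 1 ≤ W ∧ ∀ x y, |u x - u y| ≤ W * dist x y ^ s := by
  obtain ⟨L, hL⟩ := hu.lipschitzWith_of_hasCompactSupport hc (by simp)
  obtain ⟨M, hM⟩ := hc.exists_bound_of_continuous hu.continuous
  have hM0 : 0 ≤ M := (norm_nonneg _).trans (hM 0)
  refine ⟨1 + L + 2 * M, by have := L.2; linarith [L.coe_nonneg], fun x y => ?_⟩
  have hr : 0 ≤ dist x y := dist_nonneg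
  have hrs : 0 ≤ dist x y ^ s := Real.rpow_nonneg hr s
  rcases le_total (dist x y) 1 with h | h
  · have h1 : |u x - u y| ≤ L * dist x y := by
      have := hL.dist_le_mul x y
      rwa [Real.dist_eq] at this
    have h2 : dist x y ≤ dist x y ^ s := by
      rcases hr.eq_or_lt with h0 | h0
      · rw [← h0]; exact Real.rpow_nonneg le_rfl s
      · exact Real.self_le_rpow_of_le_one hr h hs.2.le
    have h3 : (L : ℝ) * dist x y ≤ L * dist x y ^ s := by gcongr
    nlinarith [mul_nonneg hM0 hrs]
  · have h1 : |u x - u y| ≤ 2 * M := by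
      have h1 := abs_sub (u x) (u y)
      have h2 := hM x
      have h3 := hM y
      rw [Real.norm_eq_abs] at h2 h3
      linarith
    have h2 : 1 ≤ dist x y ^ s := Real.one_le_rpow h hs.1.le
    nlinarith [mul_nonneg L.coe_nonneg hrs, mul_le_mul_of_nonneg_left h2 hM0]

theorem aux_pt (N : ℕ) (s p W a r : ℝ) (hs : 0 < s) (hp : 1 < p) (hW : 1 ≤ W) (ha : 0 ≤ a)
    (hr : 0 ≤ r) (h : a ≤ W * r ^ s) :
    a ^ p / r ^ ((N : ℝ) + s * p) ≤ W ^ (p - 1) * (a ^ (1 : ℝ) / r ^ ((N : ℝ) + s * 1)) := by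
  rcases ha.eq_or_lt with h0 | h0
  · rw [← h0, Real.zero_rpow (by linarith), Real.zero_rpow (by norm_num)]; simp
  rcases hr.eq_or_lt with hr0 | hr0
  · rw [← hr0, Real.zero_rpow hs.ne'] at h; linarith
  have e1 : a ^ p = a ^ (p - 1) * a ^ (1 : ℝ) := by
    rw [← Real.rpow_add h0]; ring_nf
  have e2 : r ^ ((N : ℝ) + s * p) = (r ^ s) ^ (p - 1) * r ^ ((N : ℝ) + s * 1) := by
    rw [← Real.rpow_mul hr, ← Real.rpow_add hr0]; ring_nf
  have e3 : a ^ (p - 1) ≤ W ^ (p - 1) * (r ^ s) ^ (p - 1) := by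
    rw [← Real.mul_rpow (by linarith) (by positivity)]
    exact Real.rpow_le_rpow ha h (by linarith)
  rw [e1, e2, div_le_iff₀ (by positivity)]
  have : W ^ (p - 1) * (a ^ (1 : ℝ) / r ^ ((N : ℝ) + s * 1)) *
      ((r ^ s) ^ (p - 1) * r ^ ((N : ℝ) + s * 1)) = W ^ (p - 1) * (r ^ s) ^ (p - 1) * a ^ (1:ℝ) := by
    field_simp
  rw [this]
  gcongr

theorem aux_gag (N : ℕ) (s p W c : ℝ) (hs : 0 < s) (hp : 1 < p) (hW : 1 ≤ W) (hc : 0 ≤ c)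
    (u : EuclideanSpace ℝ (Fin N) → ℝ) (h : ∀ x y, |u x - u y| ≤ W * dist x y ^ s) :
    gagliardo N s p Set.univ (fun x => c * u x) ≤
      ENNReal.ofReal (c ^ p * W ^ (p - 1)) * gagliardo N s 1 Set.univ u := by
  unfold gagliardo
  rw [← lintegral_const_mul' _ _ ENNReal.ofReal_ne_top]
  refine lintegral_mono fun x => ?_
  rw [← lintegral_const_mul' _ _ ENNReal.ofReal_ne_top]
  refine lintegral_mono fun y => ?_
  have hW0 : 0 ≤ W := by linarith
  rw [← ENNReal.ofReal_mul (by positivity)]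
  apply ENNReal.ofReal_le_ofReal
  rw [← mul_sub, abs_mul, abs_of_nonneg hc, Real.mul_rpow hc (abs_nonneg _), mul_div_assoc, mul_assoc]
  exact mul_le_mul_of_nonneg_left
    (aux_pt N s p W _ _ hs hp hW (abs_nonneg _) dist_nonneg (h x y)) (by positivity)

theorem aux_int_s16 (N : ℕ) (s : ℝ) (hs : s ∈ Set.Ioo (0 : ℝ) 1)
    (Ω : Set (EuclideanSpace ℝ (Fin N))) (hop : IsOpen Ω) (hfr : (frontier Ω).Nonempty)
    (u : EuclideanSpace ℝ (Fin N) → ℝ) (hu : Continuous u) (hc : HasCompactSupport u)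
    (hsub : tsupport u ⊆ Ω)
    (hI : (∫ x in Ω, |u x| ^ (1:ℝ) / Metric.infDist x (frontier Ω) ^ (s * 1)) = 1) :
    Tendsto (fun p : ℝ => ∫ x in Ω, |u x| ^ p / Metric.infDist x (frontier Ω) ^ (s * p))
      (nhdsWithin 1 (Set.Ioi 1)) (nhds 1) := by
  set g : EuclideanSpace ℝ (Fin N) → ℝ := fun x => |u x| / Metric.infDist x (frontier Ω) ^ s with hg
  have hg0 : ∀ x, 0 ≤ g x := fun x =>
    div_nonneg (abs_nonneg _) (Real.rpow_nonneg Metric.infDist_nonneg _)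
  have hgp : ∀ p : ℝ, ∀ x,
      |u x| ^ p / Metric.infDist x (frontier Ω) ^ (s * p) = g x ^ p := fun p x => by
    rw [hg, Real.div_rpow (abs_nonneg _) (Real.rpow_nonneg Metric.infDist_nonneg _),
      ← Real.rpow_mul Metric.infDist_nonneg]
  simp only [hgp] at hI ⊢
  have hgint : Integrable g (volume.restrict Ω) := by
    by_contra hcon
    simp only [Real.rpow_one] at hI
    rw [integral_undef hcon] at hI
    norm_num at hI
  have hcont : ContinuousOn g (tsupport u) := by
    apply ContinuousOn.div (hu.abs.continuousOn)
    · exact (Metric.continuous_infDist_pt _).continuousOn.rpow_const fun x _ => Or.inr hs.1.le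
    · intro x hx
      have : 0 < Metric.infDist x (frontier Ω) := by
        rw [← isClosed_frontier.notMem_iff_infDist_pos hfr]
        intro hxf
        rw [hop.frontier_eq] at hxf
        exact hxf.2 (hsub hx)
      exact (Real.rpow_pos_of_pos this s).ne'
  obtain ⟨M, hM⟩ := IsCompact.exists_bound_of_continuousOn hc hcont
  have hb : ∀ x, g x ≤ max 1 M := fun x => by
    by_cases hx : x ∈ tsupport u
    · exact (le_abs_self _).trans ((hM x hx).trans (le_max_right _ _))
    · have : g x = 0 := by simp [hg, image_eq_zero_of_notMem_tsupport hx]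
      rw [this]; positivity
  suffices hmain : Tendsto (fun p : ℝ => ∫ x in Ω, g x ^ p) (nhdsWithin 1 (Set.Ioi 1))
      (nhds (∫ x in Ω, g x ^ (1:ℝ))) by rwa [hI] at hmain
  apply tendsto_integral_filter_of_dominated_convergence (fun x => max 1 M * g x)
  · exact Eventually.of_forall fun p =>
      (hgint.aemeasurable.pow_const p).aestronglyMeasurable
  · have : Set.Ioo (1:ℝ) 2 ∈ nhdsWithin 1 (Set.Ioi 1) := Ioo_mem_nhdsGT (by norm_num)
    filter_upwards [this] with p hp
    refine Eventually.of_forall fun x => ?_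
    rw [Real.norm_of_nonneg (Real.rpow_nonneg (hg0 x) p)]
    rcases (hg0 x).eq_or_lt with h | h
    · rw [← h, Real.zero_rpow (by linarith [hp.1])]; simp
    · have : g x ^ p = g x ^ (p - 1) * g x := by
        nth_rewrite 3 [← Real.rpow_one (g x)]
        rw [← Real.rpow_add h]; ring_nf
      rw [this]
      gcongr
      calc g x ^ (p - 1) ≤ (max 1 M) ^ (p - 1) :=
            Real.rpow_le_rpow (hg0 x) (hb x) (by linarith [hp.1])
        _ ≤ (max 1 M) ^ (1:ℝ) :=
            Real.rpow_le_rpow_of_exponent_le (le_max_left _ _) (by linarith [hp.2])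
        _ = _ := Real.rpow_one _
  · exact hgint.const_mul _
  · refine Eventually.of_forall fun x => ?_
    exact ((Real.continuousAt_const_rpow' one_ne_zero).tendsto).mono_left nhdsWithin_le_nhds

/-- for a nonempty convex open `Ω ⊊ ℝ^N`,
`limsup_{p→1⁺} 𝔥_{s,p}(Ω) ≤ 𝔥_{s,1}(Ω)`. -/
theorem hardy_limsup_le (N : ℕ) (hN : 0 < N) (s : ℝ) (hs : s ∈ Set.Ioo (0 : ℝ) 1)
    (Ω : Set (EuclideanSpace ℝ (Fin N))) (hne : Ω.Nonempty) (hop : IsOpen Ω)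
    (hconv : Convex ℝ Ω) (hproper : Ω ≠ Set.univ) :
    Filter.limsup (fun p : ℝ => hardyConst N s p Ω) (nhdsWithin 1 (Set.Ioi 1)) ≤
      hardyConst N s 1 Ω := by
  have hfr : (frontier Ω).Nonempty := by
    rw [Set.nonempty_iff_ne_empty]
    intro h
    rcases isClopen_iff.1 (isClopen_iff_frontier_eq_empty.2 h) with h | h
    · exact hne.ne_empty h
    · exact hproper h
  refine le_sInf ?_
  rintro c ⟨u, hu, hc, hsub, hI, rfl⟩
  obtain ⟨W, hW, hWb⟩ := aux_holder N s hs u hu hc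
  have hT := aux_int_s16 N s hs Ω hop hfr u hu.continuous hc hsub hI
  set I : ℝ → ℝ := fun p => ∫ x in Ω, |u x| ^ p / Metric.infDist x (frontier Ω) ^ (s * p) with hIdef
  have hF : Tendsto (fun p : ℝ => ENNReal.ofReal ((I p)⁻¹ * W ^ (p - 1)) *
      gagliardo N s 1 Set.univ u) (nhdsWithin 1 (Set.Ioi 1)) (nhds (gagliardo N s 1 Set.univ u)) := by
    have h1 : Tendsto (fun p : ℝ => W ^ (p - 1)) (nhdsWithin 1 (Set.Ioi 1)) (nhds 1) := by
      have : Continuous fun p : ℝ => W ^ (p - 1) :=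
        Continuous.rpow continuous_const (by fun_prop) fun _ => Or.inl (by linarith)
      have := this.tendsto 1
      simp only [sub_self, Real.rpow_zero] at this
      exact this.mono_left nhdsWithin_le_nhds
    have h2 := ENNReal.tendsto_ofReal ((hT.inv₀ one_ne_zero).mul h1)
    have h3 := ENNReal.Tendsto.mul_const (b := gagliardo N s 1 Set.univ u) h2 (Or.inl (by simp))
    simpa using h3
  rw [← hF.limsup_eq]
  apply Filter.limsup_le_limsup
  swap
  · isBoundedDefault
  swap
  · isBoundedDefault
  filter_upwards [hT.eventually (lt_mem_nhds (zero_lt_one)), self_mem_nhdsWithin] with p hIp hp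
  have hp1 : (1:ℝ) < p := hp
  have hp0 : p ≠ 0 := by linarith
  have hIp : 0 < I p := hIp
  set k : ℝ := ((I p)⁻¹) ^ (p⁻¹) with hk
  have hk0 : 0 < k := Real.rpow_pos_of_pos (inv_pos.2 hIp) _
  have hkp : k ^ p = (I p)⁻¹ := Real.rpow_inv_rpow (inv_pos.2 hIp).le hp0
  have hle := aux_gag N s p W k hs.1 hp1 hW hk0.le u hWb
  rw [hkp] at hle
  refine le_trans (sInf_le ?_) hle
  refine ⟨fun x => k * u x, contDiff_const.mul hu, hc.mul_left, ?_, ?_, rfl⟩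
  · exact (tsupport_mul_subset_right (f := fun _ => k) (g := u)).trans hsub
  · have : ∀ x, |k * u x| ^ p / Metric.infDist x (frontier Ω) ^ (s * p) =
        (I p)⁻¹ * (|u x| ^ p / Metric.infDist x (frontier Ω) ^ (s * p)) := fun x => by
      rw [abs_mul, abs_of_pos hk0, Real.mul_rpow hk0.le (abs_nonneg _), hkp, mul_div_assoc]
    simp only [this]
    rw [integral_const_mul]
    exact inv_mul_cancel₀ hIp.ne'
end
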